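/- arXiv:1512.01724 — 2 statements merged into one kernel-verified Lean document; each statement's English description precedes it below -/
import Mathlib

section
/- Let n ≥ 1 and let A_1,…,A_n be finitely generated abelian groups; for each i let F_i = A_i/tor(A_i) be its torsion-free part. Define abelian groups H(m,q) for 1 ≤ m ≤ n and integers q by: H(1,0) = A_1, H(1,1) = F_1, H(1,q) = 0 for q ∉ {0,1}; and for 2 ≤ m ≤ n, H(m,q) = (H(m−1,q−1) ⊗ F_m) ⊕ (H(m−1,q) ⊗ A_m) ⊕ (tor(H(m−1,q−1)) ⊗ tor(A_m)), all tensor products over ℤ. Then for every integer q, H(n,q) is isomorphic as an abelian group to (A_1 ⊗ ⋯ ⊗ A_n)^{⊕C(n−1,q)} ⊕ (F_1 ⊗ ⋯ ⊗ F_n)^{⊕C(n−1,q−1)}, where C(a,b) denotes the binomial coefficient, understood to be 0 unless 0 ≤ b ≤ a. -/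
/-- The binomial coefficient `C(a, b)` for an integer `b`, understood to be `0`
unless `0 ≤ b ≤ a`. -/
def intChoose (a : ℕ) (b : ℤ) : ℕ :=
  if 0 ≤ b then Nat.choose a b.toNat else 0

open TensorProduct

section TensorAddEquiv

variable {X Y Z V W : Type*} [AddCommGroup X] [AddCommGroup Y] [AddCommGroup Z]
  [AddCommGroup V] [AddCommGroup W]

/-- Additive equivalences induce an equivalence of tensor products over `ℤ`. -/
def tensorAddCongr (e : X ≃+ V) (f : Y ≃+ W) : X ⊗[ℤ] Y ≃+ V ⊗[ℤ] W :=
  (TensorProduct.congr e.toIntLinearEquiv f.toIntLinearEquiv).toAddEquiv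

/-- The tensor product over `ℤ` distributes over a product on the left. -/
noncomputable def tensorProdLeftAddEquiv :
    (X × Y) ⊗[ℤ] Z ≃+ (X ⊗[ℤ] Z) × (Y ⊗[ℤ] Z) :=
  ((TensorProduct.congr (AddEquiv.refl (X × Y)).toIntLinearEquiv (LinearEquiv.refl ℤ Z)).trans
    (TensorProduct.prodLeft ℤ ℤ X Y Z)).toAddEquiv

/-- The tensor product over `ℤ` distributes over a product on the right. -/
noncomputable def tensorProdRightAddEquiv :
    X ⊗[ℤ] (Y × Z) ≃+ (X ⊗[ℤ] Y) × (X ⊗[ℤ] Z) :=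
  ((TensorProduct.congr (LinearEquiv.refl ℤ X) (AddEquiv.refl (Y × Z)).toIntLinearEquiv).trans
      (TensorProduct.prodRight ℤ ℤ X Y Z)).toAddEquiv

/-- The tensor product over `ℤ` commutes with finite powers on the left. -/
noncomputable def tensorPiLeftAddEquiv (k : ℕ) :
    (Fin k → X) ⊗[ℤ] Z ≃+ (Fin k → X ⊗[ℤ] Z) :=
  ((TensorProduct.comm ℤ (Fin k → X) Z).toAddEquiv.trans
    ((TensorProduct.congr (LinearEquiv.refl ℤ Z)
        (AddEquiv.refl (Fin k → X)).toIntLinearEquiv).trans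
      (TensorProduct.piRight ℤ ℤ Z fun _ : Fin k => X)).toAddEquiv).trans
    (AddEquiv.piCongrRight fun _ => (TensorProduct.comm ℤ Z X).toAddEquiv)

/-- Powers of an additive group indexed by `Fin (a + b)` split as a product. -/
def finAddPowAddEquiv (X : Type*) [AddCommGroup X] (a b : ℕ) :
    (Fin (a + b) → X) ≃+ (Fin a → X) × (Fin b → X) where
  toEquiv := (Fin.appendEquiv a b).symm
  map_add' _ _ := rfl

/-- A power of a product is the product of the powers. -/
def piProdAddEquiv (ι X Y : Type*) [AddCommGroup X] [AddCommGroup Y] :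
    (ι → X × Y) ≃+ (ι → X) × (ι → Y) where
  toFun f := (fun i => (f i).1, fun i => (f i).2)
  invFun p i := (p.1 i, p.2 i)
  map_add' _ _ := rfl

end TensorAddEquiv

namespace AddMonoid.ExponentExists

variable {X Y : Type*} [AddCommGroup X] [AddCommGroup Y]

lemma tensor_left (h : AddMonoid.ExponentExists X) : AddMonoid.ExponentExists (X ⊗[ℤ] Y) := by
  obtain ⟨n, hn, h⟩ := h
  refine ⟨n, hn, fun z => ?_⟩
  induction z with
  | zero => simp
  | tmul x y => rw [TensorProduct.smul_tmul', h, TensorProduct.zero_tmul]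
  | add a b ha hb => rw [nsmul_add, ha, hb, add_zero]

lemma tensor_right (h : AddMonoid.ExponentExists Y) : AddMonoid.ExponentExists (X ⊗[ℤ] Y) := by
  obtain ⟨n, hn, h⟩ := h
  refine ⟨n, hn, fun z => ?_⟩
  induction z with
  | zero => simp
  | tmul x y => rw [← TensorProduct.tmul_smul, h, TensorProduct.tmul_zero]
  | add a b ha hb => rw [nsmul_add, ha, hb, add_zero]

lemma prod_of_both (hX : AddMonoid.ExponentExists X) (hY : AddMonoid.ExponentExists Y) :
    AddMonoid.ExponentExists (X × Y) := by
  obtain ⟨n, hn, hX⟩ := hX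
  obtain ⟨m, hm, hY⟩ := hY
  refine ⟨n * m, Nat.mul_pos hn hm, fun ⟨x, y⟩ => Prod.ext ?_ ?_⟩
  · change (n * m) • x = 0
    rw [mul_nsmul, hX, nsmul_zero]
  · change (n * m) • y = 0
    rw [mul_nsmul', hY, nsmul_zero]

lemma pow (ι : Type*) (h : AddMonoid.ExponentExists X) : AddMonoid.ExponentExists (ι → X) := by
  obtain ⟨n, hn, h⟩ := h
  exact ⟨n, hn, fun f => funext fun i => h (f i)⟩

end AddMonoid.ExponentExists

section Splitting

variable {X P S : Type*} [AddCommGroup X] [AddCommGroup P] [AddCommGroup S]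

/-- An element of `P × S` with `P` torsion-free and `S` of bounded exponent is torsion exactly when
its first component vanishes. -/
lemma mem_torsion_iff_of_addEquiv_prod [IsAddTorsionFree P] (hS : AddMonoid.ExponentExists S)
    (e : X ≃+ P × S) (x : X) : x ∈ AddCommGroup.torsion X ↔ (e x).1 = 0 := by
  change IsOfFinAddOrder x ↔ _
  rw [isOfFinAddOrder_iff_nsmul_eq_zero]
  constructor
  · rintro ⟨n, hn, hx⟩
    have h : n • (e x).1 = 0 := by
      rw [← Prod.smul_fst, ← map_nsmul, hx, map_zero, Prod.fst_zero]
    exact (nsmul_eq_zero_iff_right hn.ne').mp h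
  · intro hx
    obtain ⟨n, hn, hS⟩ := hS
    refine ⟨n, hn, e.injective ?_⟩
    rw [map_nsmul, map_zero]
    exact Prod.ext (by simp [hx]) (by simp [hS])

lemma nonempty_torsion_addEquiv [IsAddTorsionFree P] (hS : AddMonoid.ExponentExists S)
    (e : X ≃+ P × S) : Nonempty (AddCommGroup.torsion X ≃+ S) := by
  have hmem := mem_torsion_iff_of_addEquiv_prod hS e
  exact ⟨{
    toFun := fun x => (e x).2
    invFun := fun s => ⟨e.symm (0, s), (hmem _).mpr (by simp)⟩
    left_inv := fun x => Subtype.ext <| by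
      have hx := (hmem x).mp x.2
      rw [e.symm_apply_eq]
      exact Prod.ext hx.symm rfl
    right_inv := fun s => by simp
    map_add' := fun x y => by simp }⟩

lemma nonempty_quotient_torsion_addEquiv [IsAddTorsionFree P] (hS : AddMonoid.ExponentExists S)
    (e : X ≃+ P × S) : Nonempty ((X ⧸ AddCommGroup.torsion X) ≃+ P) := by
  let φ : X →+ P := (AddMonoidHom.fst P S).comp e.toAddMonoidHom
  have hφ : Function.Surjective φ := fun p => ⟨e.symm (p, 0), by simp [φ]⟩
  have hker : AddCommGroup.torsion X = φ.ker :=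
    AddSubgroup.ext fun x => mem_torsion_iff_of_addEquiv_prod hS e x
  exact ⟨(QuotientAddGroup.quotientAddEquivOfEq hker).trans
    (QuotientAddGroup.quotientKerEquivOfSurjective φ hφ)⟩

lemma isAddTorsionFree_of_addEquiv [IsAddTorsionFree P] (e : X ≃+ P) : IsAddTorsionFree X :=
  Function.Injective.isAddTorsionFree e.toAddMonoidHom e.injective

/-- A finitely generated abelian group splits as the product of its free quotient and its torsion
subgroup, the latter having finite exponent. -/
lemma AddGroup.FG.exists_split (X : Type*) [AddCommGroup X] [AddGroup.FG X] :
    (∃ n : ℕ, Nonempty ((X ⧸ AddCommGroup.torsion X) ≃+ (Fin n → ℤ))) ∧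
      AddMonoid.ExponentExists (AddCommGroup.torsion X) ∧
      Nonempty (X ≃+ (X ⧸ AddCommGroup.torsion X) × AddCommGroup.torsion X) := by
  obtain ⟨n, ι, _, p, hp, k, ⟨e⟩⟩ := AddCommGroup.equiv_free_prod_directSum_zmod X
  have : ∀ i, NeZero (p i ^ k i) := fun i => ⟨pow_ne_zero _ (hp i).ne_zero⟩
  have : Finite (DirectSum ι fun i => ZMod (p i ^ k i)) := by
    classical
    exact Finite.of_equiv _ (DirectSum.addEquivProd fun i => ZMod (p i ^ k i)).symm.toEquiv
  have hS : AddMonoid.ExponentExists (DirectSum ι fun i => ZMod (p i ^ k i)) := .of_finite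
  let e' := e.trans
    (AddEquiv.prodCongr (Finsupp.linearEquivFunOnFinite ℤ ℤ (Fin n)).toAddEquiv (AddEquiv.refl _))
  obtain ⟨t⟩ := nonempty_torsion_addEquiv hS e'
  obtain ⟨f⟩ := nonempty_quotient_torsion_addEquiv hS e'
  refine ⟨⟨n, ⟨f⟩⟩, ?_, ⟨e'.trans (f.symm.prodCongr t.symm)⟩⟩
  obtain ⟨N, hN, h⟩ := hS
  exact ⟨N, hN, fun x => t.injective (by rw [map_nsmul, h, map_zero])⟩

lemma IsAddTorsionFree.tensor_of_addEquiv [IsAddTorsionFree P] {n : ℕ} (e : X ≃+ (Fin n → ℤ)) :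
    IsAddTorsionFree (P ⊗[ℤ] X) :=
  isAddTorsionFree_of_addEquiv
    ((tensorAddCongr (AddEquiv.refl P) e).trans
      ((TensorProduct.congr (LinearEquiv.refl ℤ P)
        (AddEquiv.refl (Fin n → ℤ)).toIntLinearEquiv).trans
        (TensorProduct.piScalarRight ℤ ℤ P (Fin n))).toAddEquiv)

/-- The tensor product of two split groups splits. -/
noncomputable def tensorSplitAddEquiv {Y F T : Type*} [AddCommGroup Y] [AddCommGroup F]
    [AddCommGroup T] (e : X ≃+ P × S) (f : Y ≃+ F × T) :
    X ⊗[ℤ] Y ≃+ (P ⊗[ℤ] F) × ((P ⊗[ℤ] T) × ((S ⊗[ℤ] F) × (S ⊗[ℤ] T))) :=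
  ((tensorAddCongr e f).trans tensorProdLeftAddEquiv).trans
    ((tensorProdRightAddEquiv.prodCongr tensorProdRightAddEquiv).trans AddEquiv.prodAssoc)

/-- The Künneth terms `X ⊗ F`, `P ⊗ Y` and `S ⊗ T` for `X ≅ P × S` and `Y ≅ F × T` add up to
`X ⊗ Y` and `P ⊗ F`. -/
noncomputable def kunnethTermsAddEquiv {Y F T : Type*} [AddCommGroup Y] [AddCommGroup F]
    [AddCommGroup T] (e : X ≃+ P × S) (f : Y ≃+ F × T) :
    (X ⊗[ℤ] F) × ((P ⊗[ℤ] Y) × (S ⊗[ℤ] T)) ≃+ (X ⊗[ℤ] Y) × (P ⊗[ℤ] F) :=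
  ((((tensorAddCongr e (AddEquiv.refl F)).trans tensorProdLeftAddEquiv).prodCongr
    (((tensorAddCongr (AddEquiv.refl P) f).trans tensorProdRightAddEquiv).prodCongr
      (AddEquiv.refl (S ⊗[ℤ] T)))).trans
    { toFun := fun x => ((x.1.1, x.2.1.2, x.1.2, x.2.2), x.2.1.1)
      invFun := fun y => ((y.1.1, y.1.2.2.1), (y.2, y.1.2.1), y.1.2.2.2)
      map_add' := fun _ _ => rfl }).trans
    ((tensorSplitAddEquiv e f).symm.prodCongr (AddEquiv.refl (P ⊗[ℤ] F)))

/-- One step of the Künneth recursion: `H` and `K` stand for the homology groups in consecutive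
degrees, and `X ≅ P × S` and `Y ≅ F × T` are splittings into a torsion-free part and a torsion
part. -/
lemma nonempty_kunneth_step {H K Y F T : Type*} [AddCommGroup H] [AddCommGroup K]
    [AddCommGroup Y] [AddCommGroup F] [AddCommGroup T] [IsAddTorsionFree P]
    (hS : AddMonoid.ExponentExists S) (e : X ≃+ P × S) (f : Y ≃+ F × T) {a b c : ℕ}
    (h : H ≃+ (Fin b → X) × (Fin c → P)) (h' : K ≃+ (Fin a → X) × (Fin b → P)) :
    Nonempty ((H ⊗[ℤ] F) × ((K ⊗[ℤ] Y) × (AddCommGroup.torsion H ⊗[ℤ] T)) ≃+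
      (Fin (a + b) → X ⊗[ℤ] Y) × (Fin (b + c) → P ⊗[ℤ] F)) := by
  have hsplit : H ≃+ ((Fin b → P) × (Fin c → P)) × (Fin b → S) :=
    h.trans ((((AddEquiv.piCongrRight fun _ => e).trans
        (piProdAddEquiv (Fin b) P S)).prodCongr (AddEquiv.refl (Fin c → P))).trans
      { toFun := fun x => ((x.1.1, x.2), x.1.2)
        invFun := fun y => ((y.1.1, y.2), y.1.2)
        map_add' := fun _ _ => rfl })
  obtain ⟨t⟩ := nonempty_torsion_addEquiv (hS.pow (Fin b)) hsplit
  have e₁ : H ⊗[ℤ] F ≃+ (Fin b → X ⊗[ℤ] F) × (Fin c → P ⊗[ℤ] F) :=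
    ((tensorAddCongr h (AddEquiv.refl F)).trans tensorProdLeftAddEquiv).trans
      ((tensorPiLeftAddEquiv b).prodCongr (tensorPiLeftAddEquiv c))
  have e₂ : K ⊗[ℤ] Y ≃+ (Fin a → X ⊗[ℤ] Y) × (Fin b → P ⊗[ℤ] Y) :=
    ((tensorAddCongr h' (AddEquiv.refl Y)).trans tensorProdLeftAddEquiv).trans
      ((tensorPiLeftAddEquiv a).prodCongr (tensorPiLeftAddEquiv b))
  have e₃ : AddCommGroup.torsion H ⊗[ℤ] T ≃+ (Fin b → S ⊗[ℤ] T) :=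
    (tensorAddCongr t (AddEquiv.refl T)).trans (tensorPiLeftAddEquiv b)
  have k : (Fin b → (X ⊗[ℤ] F) × ((P ⊗[ℤ] Y) × (S ⊗[ℤ] T))) ≃+
      (Fin b → X ⊗[ℤ] Y) × (Fin b → P ⊗[ℤ] F) :=
    (AddEquiv.piCongrRight fun _ => kunnethTermsAddEquiv e f).trans
      (piProdAddEquiv (Fin b) (X ⊗[ℤ] Y) (P ⊗[ℤ] F))
  have r : ((Fin b → X ⊗[ℤ] F) × (Fin c → P ⊗[ℤ] F)) ×
        (((Fin a → X ⊗[ℤ] Y) × (Fin b → P ⊗[ℤ] Y)) × (Fin b → S ⊗[ℤ] T)) ≃+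
      (Fin b → (X ⊗[ℤ] F) × ((P ⊗[ℤ] Y) × (S ⊗[ℤ] T))) ×
        ((Fin a → X ⊗[ℤ] Y) × (Fin c → P ⊗[ℤ] F)) :=
    { toFun := fun x => (fun i => (x.1.1 i, x.2.1.2 i, x.2.2 i), x.2.1.1, x.1.2)
      invFun := fun y => ((fun i => (y.1 i).1, y.2.2),
        (y.2.1, fun i => (y.1 i).2.1), fun i => (y.1 i).2.2)
      map_add' := fun _ _ => rfl }
  have s : ((Fin b → X ⊗[ℤ] Y) × (Fin b → P ⊗[ℤ] F)) ×
        ((Fin a → X ⊗[ℤ] Y) × (Fin c → P ⊗[ℤ] F)) ≃+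
      ((Fin a → X ⊗[ℤ] Y) × (Fin b → X ⊗[ℤ] Y)) ×
        ((Fin b → P ⊗[ℤ] F) × (Fin c → P ⊗[ℤ] F)) :=
    { toFun := fun x => ((x.2.1, x.1.1), (x.1.2, x.2.2))
      invFun := fun y => ((y.1.2, y.2.1), (y.1.1, y.2.2))
      map_add' := fun _ _ => rfl }
  exact ⟨(((e₁.prodCongr (e₂.prodCongr e₃)).trans r).trans
    ((k.prodCongr (AddEquiv.refl _)).trans s)).trans
    ((finAddPowAddEquiv (X ⊗[ℤ] Y) a b).symm.prodCongr
      (finAddPowAddEquiv (P ⊗[ℤ] F) b c).symm)⟩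

end Splitting

lemma intChoose_succ (a : ℕ) (q : ℤ) :
    intChoose (a + 1) q = intChoose a q + intChoose a (q - 1) := by
  rcases lt_trichotomy q 0 with hq | rfl | hq
  · simp [intChoose, hq.not_ge, show ¬ (1 ≤ q) by omega]
  · simp [intChoose]
  · obtain ⟨k, rfl⟩ : ∃ k : ℕ, q = k + 1 := ⟨(q - 1).toNat, by omega⟩
    have hk : ((k : ℤ) + 1).toNat = k + 1 := by omega
    simp [intChoose, hk, show (0 : ℤ) ≤ k + 1 by omega, Nat.choose_succ_succ, add_comm]

lemma intChoose_zero (q : ℤ) : intChoose 0 q = if q = 0 then 1 else 0 := by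
  rcases lt_trichotomy q 0 with hq | rfl | hq
  · simp [intChoose, hq.not_ge, hq.ne]
  · simp [intChoose]
  · obtain ⟨k, rfl⟩ : ∃ k : ℕ, q = k + 1 := ⟨(q - 1).toNat, by omega⟩
    have hk : ((k : ℤ) + 1).toNat = k + 1 := by omega
    simp [intChoose, hk, show (k : ℤ) + 1 ≠ 0 by omega]

/-- The groups `A 1, …, A n` are finitely generated abelian groups,
`H : ℕ → ℤ → Type` is a family realizing the Künneth recursion, and
`TA m` (resp. `TF m`) realizes the iterated tensor product `A 1 ⊗ ⋯ ⊗ A m`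
(resp. `F 1 ⊗ ⋯ ⊗ F m`, where `F i = A i / tor (A i)`).  Then
`H n q ≅ (A 1 ⊗ ⋯ ⊗ A n)^{C(n-1,q)} ⊕ (F 1 ⊗ ⋯ ⊗ F n)^{C(n-1,q-1)}`. -/
theorem statement0
    (n : ℕ) (hn : 1 ≤ n)
    (A : ℕ → Type) [∀ i, AddCommGroup (A i)] [∀ i, AddGroup.FG (A i)]
    (H : ℕ → ℤ → Type) [∀ m q, AddCommGroup (H m q)]
    (TA TF : ℕ → Type) [∀ m, AddCommGroup (TA m)] [∀ m, AddCommGroup (TF m)]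
    (hH10 : Nonempty (H 1 0 ≃+ A 1))
    (hH11 : Nonempty (H 1 1 ≃+ (A 1 ⧸ AddCommGroup.torsion (A 1))))
    (hH1q : ∀ q : ℤ, q ≠ 0 → q ≠ 1 → Subsingleton (H 1 q))
    (hHrec : ∀ m : ℕ, 2 ≤ m → m ≤ n → ∀ q : ℤ,
      Nonempty (H m q ≃+
        (TensorProduct ℤ (H (m - 1) (q - 1)) (A m ⧸ AddCommGroup.torsion (A m))) ×
        (TensorProduct ℤ (H (m - 1) q) (A m)) ×
        (TensorProduct ℤ (AddCommGroup.torsion (H (m - 1) (q - 1)))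
          (AddCommGroup.torsion (A m)))))
    (hTA1 : Nonempty (TA 1 ≃+ A 1))
    (hTArec : ∀ m : ℕ, 2 ≤ m → m ≤ n →
      Nonempty (TA m ≃+ TensorProduct ℤ (TA (m - 1)) (A m)))
    (hTF1 : Nonempty (TF 1 ≃+ (A 1 ⧸ AddCommGroup.torsion (A 1))))
    (hTFrec : ∀ m : ℕ, 2 ≤ m → m ≤ n →
      Nonempty (TF m ≃+ TensorProduct ℤ (TF (m - 1)) (A m ⧸ AddCommGroup.torsion (A m)))) :
    ∀ q : ℤ, Nonempty (H n q ≃+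
      ((Fin (intChoose (n - 1) q) → TA n) × (Fin (intChoose (n - 1) (q - 1)) → TF n))) := by
  have key : ∀ m : ℕ, m + 1 ≤ n →
      IsAddTorsionFree (TF (m + 1)) ∧
      (∃ (S : Type) (_ : AddCommGroup S), AddMonoid.ExponentExists S ∧
        Nonempty (TA (m + 1) ≃+ TF (m + 1) × S)) ∧
      ∀ q : ℤ, Nonempty (H (m + 1) q ≃+
        ((Fin (intChoose m q) → TA (m + 1)) × (Fin (intChoose m (q - 1)) → TF (m + 1)))) := by
    intro m
    induction m with
    | zero =>
      intro _
      obtain ⟨⟨k, ⟨f⟩⟩, hT, ⟨s⟩⟩ := AddGroup.FG.exists_split (A 1)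
      obtain ⟨eA⟩ := hTA1
      obtain ⟨eF⟩ := hTF1
      obtain ⟨h0⟩ := hH10
      obtain ⟨h1⟩ := hH11
      refine ⟨isAddTorsionFree_of_addEquiv (eF.trans f),
        ⟨AddCommGroup.torsion (A 1), inferInstance, hT,
          ⟨(eA.trans s).trans (eF.symm.prodCongr (AddEquiv.refl _))⟩⟩, fun q => ?_⟩
      rw [intChoose_zero, intChoose_zero]
      by_cases hq0 : q = 0
      · subst hq0
        rw [if_pos rfl, if_neg (by omega)]
        exact ⟨(h0.trans eA.symm).trans
          ((AddEquiv.funUnique (Fin 1) (TA 1)).symm.trans AddEquiv.prodUnique.symm)⟩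
      by_cases hq1 : q = 1
      · subst hq1
        rw [if_neg (by omega), if_pos (by omega)]
        exact ⟨(h1.trans eF.symm).trans
          ((AddEquiv.funUnique (Fin 1) (TF 1)).symm.trans AddEquiv.uniqueProd.symm)⟩
      · rw [if_neg hq0, if_neg (by omega)]
        have := hH1q q hq0 hq1
        have : Unique (H 1 q) := uniqueOfSubsingleton 0
        have : Unique ((Fin 0 → TA (0 + 1)) × (Fin 0 → TF (0 + 1))) := uniqueOfSubsingleton 0
        exact ⟨AddEquiv.ofUnique⟩
    | succ m ih =>
      intro hm
      obtain ⟨_, ⟨S, _, hS, ⟨e⟩⟩, hH⟩ := ih (by omega)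
      obtain ⟨⟨k, ⟨f⟩⟩, hT, ⟨s⟩⟩ := AddGroup.FG.exists_split (A (m + 2))
      obtain ⟨eA⟩ := hTArec (m + 2) (by omega) hm
      obtain ⟨eF⟩ := hTFrec (m + 2) (by omega) hm
      have : IsAddTorsionFree
          (TF (m + 2 - 1) ⊗[ℤ] (A (m + 2) ⧸ AddCommGroup.torsion (A (m + 2)))) :=
        IsAddTorsionFree.tensor_of_addEquiv (P := TF (m + 1)) f
      refine ⟨isAddTorsionFree_of_addEquiv eF, ⟨_, inferInstance,
        hT.tensor_right.prod_of_both (hS.tensor_left.prod_of_both hS.tensor_left),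
        ⟨(eA.trans (tensorSplitAddEquiv e s)).trans
          (eF.symm.prodCongr (AddEquiv.refl _))⟩⟩, fun q => ?_⟩
      obtain ⟨r⟩ := hHrec (m + 2) (by omega) hm q
      obtain ⟨h⟩ := hH (q - 1)
      obtain ⟨h'⟩ := hH q
      obtain ⟨w⟩ := nonempty_kunneth_step hS e s h h'
      rw [intChoose_succ, intChoose_succ]
      exact ⟨(r.trans w).trans ((AddEquiv.piCongrRight fun _ => eA.symm).prodCongr
        (AddEquiv.piCongrRight fun _ => eF.symm))⟩
  obtain ⟨m, rfl⟩ : ∃ m, n = m + 1 := ⟨n - 1, by omega⟩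
  exact (key m le_rfl).2.2
end

section
/- For every k ≥ 2 and r ≥ 1, the abelianization of the higher dimensional Thompson group 2V_{k,r} is isomorphic to: ℤ/(k−1)ℤ if k is even; ℤ/(k−1)ℤ ⊕ ℤ/2ℤ if k ≡ 1 (mod 4); and ℤ/(2k−2)ℤ if k ≡ 3 (mod 4). -/
namespace NV

/-- The Cantor space `C_k = {0,…,k-1}^ℕ` of one-sided infinite sequences. -/
abbrev Cantor (k : ℕ) : Type := ℕ → Fin k

/-- Concatenation `u·x` of a finite word `u` with an infinite sequence `x`. -/
def concat {k : ℕ} (u : List (Fin k)) (x : Cantor k) : Cantor k :=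
  fun i => if h : i < u.length then u.get ⟨i, h⟩ else x (i - u.length)

/-- The space `Y(n,k,r) = (C_k)^n × {1,…,r}`. -/
abbrev Y (n k r : ℕ) : Type := (Fin n → Cantor k) × Fin r

/-- The box `{(u_1·x_1,…,u_n·x_n, a) : x_1,…,x_n ∈ C_k}` determined by
finite words `u_1,…,u_n` and an index `a`. -/
def box {n k r : ℕ} (u : Fin n → List (Fin k)) (a : Fin r) : Set (Y n k r) :=
  {y | ∃ x : Fin n → Cantor k, y = (fun i => concat (u i) (x i), a)}

/-- A permutation of `Y(n,k,r)` is an element of the higher dimensional Thompson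
group `nV_{k,r}` if there are finitely many tuples of words and indices whose domain
boxes partition `Y(n,k,r)`, whose range boxes partition `Y(n,k,r)`, and on which `γ`
acts by the corresponding prefix substitutions. -/
def IsElement {n k r : ℕ} (γ : Equiv.Perm (Y n k r)) : Prop :=
  ∃ (m : ℕ) (u v : Fin m → Fin n → List (Fin k)) (a b : Fin m → Fin r),
    (∀ y : Y n k r, ∃! t : Fin m, y ∈ box (u t) (a t)) ∧
    (∀ y : Y n k r, ∃! t : Fin m, y ∈ box (v t) (b t)) ∧
    (∀ (t : Fin m) (x : Fin n → Cantor k),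
      γ (fun i => concat (u t i) (x i), a t) = (fun i => concat (v t i) (x i), b t))

/-- The underlying set of the higher dimensional Thompson group `nV_{k,r}`,
as a set of permutations of `Y(n,k,r)`. -/
def thompsonSet (n k r : ℕ) : Set (Equiv.Perm (Y n k r)) := {γ | IsElement γ}

end NV

namespace NV

variable {k r : ℕ}

theorem concat_append (u v : List (Fin k)) (x : Cantor k) :
    concat (u ++ v) x = concat u (concat v x) := by
  funext n
  simp only [concat, List.length_append, List.get_eq_getElem]
  by_cases h : n < u.length
  · have h' : n < u.length + v.length := by omega
    simp [h, h', List.getElem_append_left]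
  · by_cases h' : n < u.length + v.length
    · have h'' : n - u.length < v.length := by omega
      simp [h, h', h'', List.getElem_append_right (not_lt.mp h)]
    · have h'' : ¬ n - u.length < v.length := by omega
      simp [h, h', h'', Nat.sub_sub]

theorem concat_apply_of_getElem? {u : List (Fin k)} {n : ℕ} {d : Fin k} (h : u[n]? = some d)
    (x : Cantor k) : concat u x n = d := by
  obtain ⟨hn, rfl⟩ := List.getElem?_eq_some_iff.mp h
  simp [concat, hn]

theorem concat_length_add (u : List (Fin k)) (x : Cantor k) (n : ℕ) :
    concat u x (u.length + n) = x n := by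
  simp [concat]

theorem concat_injective (u : List (Fin k)) : Function.Injective (concat u) := by
  intro x y h
  funext n
  rw [← concat_length_add u x n, h, concat_length_add]

theorem exists_concat_eq {u : List (Fin k)} {y : Cantor k}
    (h : ∀ n d, u[n]? = some d → y n = d) : ∃ x, y = concat u x := by
  refine ⟨fun n => y (u.length + n), ?_⟩
  funext n
  by_cases hn : n < u.length
  · simp [concat, hn, h n _ (List.getElem?_eq_getElem hn)]
  · simp [concat, hn, Nat.add_sub_cancel' (not_lt.mp hn)]

theorem word_eq_of_forall_concat_eq (hk : 2 ≤ k) {u v : List (Fin k)}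
    (h : ∀ x, concat u x = concat v x) : u = v := by
  have key : ∀ {u v : List (Fin k)}, (∀ x, concat u x = concat v x) → v.length ≤ u.length := by
    intro u v h
    by_contra! hlt
    have h1 : ∀ c : Fin k, c = v[u.length] := by
      intro c
      have := congrFun (h fun _ => c) u.length
      rw [concat_apply_of_getElem? (List.getElem?_eq_getElem hlt)] at this
      simpa [concat] using this
    have := (h1 ⟨0, by omega⟩).trans (h1 ⟨1, by omega⟩).symm
    simp at this
  have hl : u.length = v.length := le_antisymm (key fun x => (h x).symm) (key h)
  refine List.ext_getElem hl fun n h1 h2 => ?_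
  have := congrFun (h fun _ => ⟨0, by omega⟩) n
  rwa [concat_apply_of_getElem? (List.getElem?_eq_getElem h1),
    concat_apply_of_getElem? (List.getElem?_eq_getElem h2)] at this

/-- The combinatorial data of a box in `Y(2,k,r)`. -/
@[ext]
structure Brick (k r : ℕ) where
  /-- The two words. -/
  word : Fin 2 → List (Fin k)
  /-- The index. -/
  idx : Fin r

namespace Brick

/-- The point of the box with the given pair of tails. -/
def pt (b : Brick k r) (x : Fin 2 → Cantor k) : Y 2 k r :=
  (fun i => concat (b.word i) (x i), b.idx)

/-- The box of `b`, as a set of points. -/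
def carrier (b : Brick k r) : Set (Y 2 k r) := box b.word b.idx

theorem pt_mem (b : Brick k r) (x : Fin 2 → Cantor k) : b.pt x ∈ b.carrier := ⟨x, rfl⟩

theorem pt_injective (b : Brick k r) : Function.Injective b.pt := by
  intro x y h
  funext i
  exact concat_injective _ (congrFun (congrArg Prod.fst h) i)

theorem mem_carrier {b : Brick k r} {y : Y 2 k r} :
    y ∈ b.carrier ↔ y.2 = b.idx ∧ ∀ s n d, (b.word s)[n]? = some d → y.1 s n = d := by
  constructor
  · rintro ⟨x, rfl⟩
    exact ⟨rfl, fun s n d h => concat_apply_of_getElem? h _⟩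
  · rintro ⟨h1, h2⟩
    choose x hx using fun s => exists_concat_eq (h2 s)
    exact ⟨x, Prod.ext (funext hx) h1⟩

theorem eq_of_forall_pt_eq (hk : 2 ≤ k) {b c : Brick k r} (h : ∀ x, b.pt x = c.pt x) : b = c := by
  refine Brick.ext (funext fun s => word_eq_of_forall_concat_eq hk fun x => ?_) ?_
  · exact congrFun (congrArg Prod.fst (h fun _ => x)) s
  · exact congrArg Prod.snd (h fun _ _ => ⟨0, by omega⟩)

/-- The `i`-th piece when `b` is cut into `k` pieces in direction `s`. -/
def child (s : Fin 2) (i : Fin k) (b : Brick k r) : Brick k r :=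
  ⟨Function.update b.word s (b.word s ++ [i]), b.idx⟩

/-- The `k` pieces of `b` in direction `s`. -/
def children (s : Fin 2) (b : Brick k r) : List (Brick k r) :=
  (List.finRange k).map fun i => b.child s i

@[simp]
theorem length_children (s : Fin 2) (b : Brick k r) : (b.children s).length = k := by
  simp [children]

theorem mem_children {s : Fin 2} {b c : Brick k r} :
    c ∈ b.children s ↔ ∃ i, b.child s i = c := by
  simp [children]

theorem word_child_self (s : Fin 2) (i : Fin k) (b : Brick k r) :
    (b.child s i).word s = b.word s ++ [i] := by
  simp [child]

theorem word_child_of_ne {s s' : Fin 2} (h : s' ≠ s) (i : Fin k) (b : Brick k r) :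
    (b.child s i).word s' = b.word s' := by
  simp [child, h]

theorem pt_child (s : Fin 2) (i : Fin k) (b : Brick k r) (x : Fin 2 → Cantor k) :
    (b.child s i).pt x = b.pt (Function.update x s (concat [i] (x s))) := by
  refine Prod.ext (funext fun s' => ?_) rfl
  by_cases h : s' = s
  · subst h
    simp [pt, word_child_self, concat_append]
  · simp [pt, word_child_of_ne h, h]

theorem child_comm (i j : Fin k) (b : Brick k r) :
    (b.child 0 i).child 1 j = (b.child 1 j).child 0 i := by
  refine Brick.ext (funext fun s => ?_) rfl
  fin_cases s <;> simp [child]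

theorem carrier_child_subset (s : Fin 2) (i : Fin k) (b : Brick k r) :
    (b.child s i).carrier ⊆ b.carrier := by
  rintro _ ⟨x, rfl⟩
  exact ⟨_, pt_child s i b x⟩

theorem mem_child {s : Fin 2} {i : Fin k} {b : Brick k r} {y : Y 2 k r} :
    y ∈ (b.child s i).carrier ↔ y ∈ b.carrier ∧ y.1 s (b.word s).length = i := by
  constructor
  · intro h
    refine ⟨carrier_child_subset s i b h, (mem_carrier.mp h).2 s _ i ?_⟩
    simp [word_child_self]
  · rintro ⟨h, h'⟩
    rw [mem_carrier] at h ⊢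
    refine ⟨h.1, fun s' n d hd => ?_⟩
    by_cases hs : s' = s
    · subst hs
      rw [word_child_self, List.getElem?_append] at hd
      split_ifs at hd with hn
      · exact h.2 _ _ _ hd
      · obtain ⟨h1, h2⟩ := List.getElem?_eq_some_iff.mp hd
        simp only [List.length_singleton] at h1
        have : n = (b.word s').length := by omega
        subst this
        simpa [h'] using h2
    · rw [word_child_of_ne hs] at hd
      exact h.2 _ _ _ hd

theorem exists_mem_child {s : Fin 2} {b : Brick k r} {y : Y 2 k r} (h : y ∈ b.carrier) :
    ∃ i, y ∈ (b.child s i).carrier :=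
  ⟨_, mem_child.mpr ⟨h, rfl⟩⟩

/-- The known digits of the points of `b`: the index comes first, and then the digits of the two
coordinates alternate. -/
def digit (b : Brick k r) : ℕ → Option ℕ
  | 0 => some b.idx
  | n + 1 => ((b.word (Fin.ofNat 2 n))[n / 2]?).map Fin.val

/-- The place of the `n`-th digit of coordinate `s` in the sequence `digit`. -/
def place (s : Fin 2) (n : ℕ) : ℕ := 2 * n + s + 1

theorem digit_place (b : Brick k r) (s : Fin 2) (n : ℕ) :
    b.digit (place s n) = ((b.word s)[n]?).map Fin.val := by
  have h1 : Fin.ofNat 2 (2 * n + s) = s := by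
    ext; simp; omega
  have h2 : (2 * n + (s : ℕ)) / 2 = n := by omega
  simp only [digit, place, h1, h2]

theorem exists_place (n : ℕ) : ∃ s l, n + 1 = place s l := by
  refine ⟨Fin.ofNat 2 n, n / 2, ?_⟩
  simp [place]; omega

theorem place_inj {s s' : Fin 2} {n n' : ℕ} : place s n = place s' n' ↔ s = s' ∧ n = n' := by
  simp only [place, Fin.ext_iff]; omega

theorem digit_place_length (b : Brick k r) (s : Fin 2) :
    b.digit (place s (b.word s).length) = none := by
  simp [digit_place]

theorem digit_child (s : Fin 2) (i : Fin k) (b : Brick k r) :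
    (b.child s i).digit = Function.update b.digit (place s (b.word s).length) (some (i : ℕ)) := by
  funext n
  rcases n with _ | n
  · rw [Function.update_of_ne (by simp [place])]; rfl
  · obtain ⟨s', l, h⟩ := exists_place n
    rw [h, digit_place]
    by_cases hs : s' = s
    · subst hs
      rw [word_child_self]
      by_cases hl : l = (b.word s').length
      · subst hl; simp
      · rw [Function.update_of_ne (by simp [place_inj, hl]), digit_place, List.getElem?_append]
        split_ifs with h'
        · rfl
        · rw [List.getElem?_eq_none (by simp; omega), List.getElem?_eq_none (by omega)]
    · rw [word_child_of_ne hs, Function.update_of_ne (by simp [place_inj, hs]), digit_place]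

/-- A place where two sequences of partially known digits have different known digits. -/
def Differ (d e : ℕ → Option ℕ) (n : ℕ) : Prop := ∃ x y, d n = some x ∧ e n = some y ∧ x ≠ y

theorem Differ.symm {d e : ℕ → Option ℕ} {n : ℕ} (h : Differ d e n) : Differ e d n := by
  obtain ⟨x, y, h1, h2, h3⟩ := h
  exact ⟨y, x, h2, h1, h3.symm⟩

/-- The boxes of `b` and `c` are separated by some digit. -/
def Sep (b c : Brick k r) : Prop := ∃ n, Differ b.digit c.digit n

theorem Sep.symm {b c : Brick k r} (h : Sep b c) : Sep c b := h.imp fun _ => Differ.symm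

theorem not_sep_self (b : Brick k r) : ¬ Sep b b := by
  rintro ⟨n, x, y, h1, h2, h3⟩
  rw [h1] at h2
  exact h3 (Option.some_inj.mp h2)

theorem Sep.ne {b c : Brick k r} (h : Sep b c) : b ≠ c := by
  rintro rfl
  exact not_sep_self b h

theorem mem_carrier_digit {b : Brick k r} {y : Y 2 k r} (h : y ∈ b.carrier) {n x : ℕ}
    (hx : b.digit n = some x) :
    x = Nat.casesOn n (y.2 : ℕ) fun n => (y.1 (Fin.ofNat 2 n) (n / 2) : ℕ) := by
  rw [mem_carrier] at h
  rcases n with _ | n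
  · simp only [digit, Option.some_inj] at hx
    simp [h.1, hx]
  · simp only [digit, Option.map_eq_some_iff] at hx
    obtain ⟨d, hd, rfl⟩ := hx
    exact congrArg Fin.val (h.2 _ _ _ hd).symm

theorem Sep.notMem {b c : Brick k r} (h : Sep b c) {y : Y 2 k r} (hb : y ∈ b.carrier) :
    y ∉ c.carrier := by
  intro hc
  obtain ⟨n, x, z, h1, h2, h3⟩ := h
  exact h3 ((mem_carrier_digit hb h1).trans (mem_carrier_digit hc h2).symm)

theorem exists_mem_of_not_sep (hk : 0 < k) {b c : Brick k r} (h : ¬ Sep b c) :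
    ∃ y, y ∈ b.carrier ∧ y ∈ c.carrier := by
  have hidx : b.idx = c.idx := by
    by_contra hne
    exact h ⟨0, _, _, rfl, rfl, fun h => hne (Fin.ext h)⟩
  have hword : ∀ (s : Fin 2) (n : ℕ) (d e : Fin k), (b.word s)[n]? = some d →
      (c.word s)[n]? = some e → d = e := by
    intro s n d e hd he
    by_contra hne
    refine h ⟨place s n, d, e, ?_, ?_, fun h => hne (Fin.ext h)⟩ <;> simp [digit_place, hd, he]
  refine ⟨(fun s n => ((b.word s)[n]?.or (c.word s)[n]?).getD ⟨0, hk⟩, b.idx),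
    mem_carrier.mpr ⟨rfl, fun s n d hd => ?_⟩, mem_carrier.mpr ⟨hidx, fun s n d hd => ?_⟩⟩
  · simp [hd]
  · rcases hb : (b.word s)[n]? with _ | e
    · simp only [hb, hd, Option.none_or, Option.getD_some]
    · simp only [hb, hword s n e d hb hd, Option.some_or, Option.getD_some]

theorem sep_of_forall_notMem (hk : 0 < k) {b c : Brick k r}
    (h : ∀ y ∈ b.carrier, y ∉ c.carrier) : Sep b c := by
  by_contra hs
  obtain ⟨y, hb, hc⟩ := exists_mem_of_not_sep hk hs
  exact h y hb hc

theorem Sep.child_left {b c : Brick k r} (h : Sep b c) (s : Fin 2) (i : Fin k) :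
    Sep (b.child s i) c := by
  obtain ⟨n, x, y, h1, h2, h3⟩ := h
  refine ⟨n, x, y, ?_, h2, h3⟩
  rw [digit_child, Function.update_of_ne ?_, h1]
  rintro rfl
  simp [digit_place_length] at h1

theorem sep_child_child {s : Fin 2} {i j : Fin k} (b : Brick k r) (h : i ≠ j) :
    Sep (b.child s i) (b.child s j) :=
  ⟨place s (b.word s).length, i, j, by simp [digit_child], by simp [digit_child],
    fun h' => h (Fin.ext h')⟩

theorem eq_of_length_eq {b c : Brick k r} {y : Y 2 k r} (hb : y ∈ b.carrier) (hc : y ∈ c.carrier)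
    (h : ∀ s, (b.word s).length = (c.word s).length) : b = c := by
  rw [mem_carrier] at hb hc
  refine Brick.ext (funext fun s => List.ext_getElem (h s) fun n h1 h2 => ?_) (hb.1 ▸ hc.1)
  exact (hb.2 s n _ (List.getElem?_eq_getElem h1)).symm.trans
    (hc.2 s n _ (List.getElem?_eq_getElem h2))

end Brick

/-- A list of boxes partitioning `Y(2,k,r)`. -/
structure IsPartition (L : List (Brick k r)) : Prop where
  cover : ∀ y, ∃ b ∈ L, y ∈ b.carrier
  pairwise : L.Pairwise Brick.Sep

theorem IsPartition.perm {L L' : List (Brick k r)} (h : IsPartition L) (hp : L.Perm L') :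
    IsPartition L' :=
  ⟨fun y => (h.cover y).imp fun _ hb => ⟨hp.mem_iff.mp hb.1, hb.2⟩,
    (hp.pairwise_iff Brick.Sep.symm).mp h.pairwise⟩

theorem IsPartition.nodup {L : List (Brick k r)} (h : IsPartition L) : L.Nodup :=
  List.nodup_iff_pairwise_ne.mpr <| h.pairwise.imp Brick.Sep.ne

theorem IsPartition.split {s : Fin 2} {b : Brick k r} {R : List (Brick k r)}
    (h : IsPartition (b :: R)) : IsPartition (b.children s ++ R) := by
  refine ⟨fun y => ?_, ?_⟩
  · obtain ⟨c, hc, hy⟩ := h.cover y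
    rcases List.mem_cons.mp hc with rfl | hc
    · obtain ⟨i, hi⟩ := Brick.exists_mem_child (s := s) hy
      exact ⟨_, List.mem_append_left _ (Brick.mem_children.mpr ⟨i, rfl⟩), hi⟩
    · exact ⟨c, List.mem_append_right _ hc, hy⟩
  · obtain ⟨h1, h2⟩ := List.pairwise_cons.mp h.pairwise
    refine List.pairwise_append.mpr ⟨?_, h2, ?_⟩
    · exact List.pairwise_map.mpr ((List.nodup_finRange k).imp fun hij => b.sep_child_child hij)
    · intro c hc d hd
      obtain ⟨i, rfl⟩ := Brick.mem_children.mp hc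
      exact (h1 d hd).child_left s i

/-- Elementary moves on lists of boxes: reordering, and cutting a box into `k` pieces. -/
inductive Move : List (Brick k r) → List (Brick k r) → Prop
  | perm {L L' : List (Brick k r)} : L.Perm L' → Move L L'
  | split (s : Fin 2) (b : Brick k r) (R : List (Brick k r)) : Move (b :: R) (b.children s ++ R)

/-- The list `L'` is obtained from `L` by elementary moves. -/
abbrev Refines (L L' : List (Brick k r)) : Prop := Relation.ReflTransGen Move L L'

theorem Refines.of_perm {L L' : List (Brick k r)} (h : L.Perm L') : Refines L L' :=
  .single (.perm h)

theorem Move.isPartition {L L' : List (Brick k r)} (h : Move L L') (hL : IsPartition L) :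
    IsPartition L' := by
  cases h with
  | perm hp => exact hL.perm hp
  | split s b R => exact hL.split

theorem Refines.isPartition {L L' : List (Brick k r)} (h : Refines L L') (hL : IsPartition L) :
    IsPartition L' := by
  induction h with
  | refl => exact hL
  | tail _ hm ih => exact hm.isPartition ih

theorem Refines.exists_length_eq {L L' : List (Brick k r)} (h : Refines L L') :
    ∃ n, L'.length + n = L.length + n * k := by
  induction h with
  | refl => exact ⟨0, by simp⟩
  | tail _ hm ih =>
    obtain ⟨n, hn⟩ := ih
    cases hm with
    | perm hp => exact ⟨n, by rw [← hp.length_eq, hn]⟩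
    | split s b R =>
      refine ⟨n + 1, ?_⟩
      simp only [List.length_cons, List.length_append, Brick.length_children] at hn ⊢
      linarith

/-- All the words of `b` in direction `s` have length `p s`. -/
def Brick.HasShape (p : Fin 2 → ℕ) (b : Brick k r) : Prop := ∀ s, (b.word s).length = p s

theorem exists_refines_hasShape (p : Fin 2 → ℕ) (L : List (Brick k r))
    (hL : ∀ b ∈ L, ∀ s, (b.word s).length ≤ p s) :
    ∃ L', Refines L L' ∧ ∀ b ∈ L', b.HasShape p := by
  classical
  let ht : Brick k r → ℕ := fun b => (k + 1) ^ (∑ s, (p s - (b.word s).length))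
  induction hN : (L.map ht).sum using Nat.strong_induction_on generalizing L with
  | _ N ih =>
    by_cases hall : ∀ b ∈ L, b.HasShape p
    · exact ⟨L, .refl, hall⟩
    · push Not at hall
      obtain ⟨b, hb, hbp⟩ := hall
      simp only [Brick.HasShape, not_forall] at hbp
      obtain ⟨s, hs⟩ := hbp
      have hlt : (b.word s).length < p s := lt_of_le_of_ne (hL b hb s) hs
      have hperm := List.perm_cons_erase hb
      have hht : ∀ i, ht (b.child s i) * (k + 1) = ht b := by
        intro i
        simp only [ht]
        rw [← pow_succ, ← Finset.add_sum_erase _ _ (Finset.mem_univ s),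
          ← Finset.add_sum_erase (a := s) Finset.univ (fun s => p s - (b.word s).length)
            (Finset.mem_univ s)]
        congr 1
        rw [Finset.sum_congr rfl fun s' hs' => by
          rw [Brick.word_child_of_ne (Finset.ne_of_mem_erase hs')], Brick.word_child_self]
        simp only [List.length_append, List.length_singleton]
        omega
      have hpos : 0 < ht b := by positivity
      have hsum : ((b.children s).map ht).sum < ht b := by
        have : ((b.children s).map ht).sum * (k + 1) = k * ht b := by
          rw [Brick.children, List.map_map, ← List.sum_map_mul_right]
          simp [hht]
        nlinarith
      obtain ⟨L', h1, h2⟩ := ih _ (by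
        rw [← hN, (hperm.map ht).sum_eq, List.map_cons, List.sum_cons]
        simpa using hsum) (b.children s ++ L.erase b) (by
          intro c hc s'
          rcases List.mem_append.mp hc with hc | hc
          · obtain ⟨i, rfl⟩ := Brick.mem_children.mp hc
            by_cases hs' : s' = s
            · subst hs'
              simpa [Brick.word_child_self] using hlt
            · rw [Brick.word_child_of_ne hs']
              exact hL b hb s'
          · exact hL c (List.mem_of_mem_erase hc) s') rfl
      exact ⟨L', (Refines.of_perm hperm).trans (.trans (.single (.split s b _)) h1), h2⟩

theorem exists_shape_bound (L : List (Brick k r)) :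
    ∃ p : Fin 2 → ℕ, ∀ b ∈ L, ∀ s, (b.word s).length ≤ p s := by
  induction L with
  | nil => exact ⟨0, by simp⟩
  | cons b L ih =>
    obtain ⟨p, hp⟩ := ih
    refine ⟨fun s => (b.word s).length + p s, fun c hc s => ?_⟩
    rcases List.mem_cons.mp hc with rfl | hc
    · exact Nat.le_add_right _ _
    · exact (hp c hc s).trans (Nat.le_add_left _ _)

theorem IsPartition.perm_of_hasShape (hk : 0 < k) {p : Fin 2 → ℕ} {L L' : List (Brick k r)}
    (hL : IsPartition L) (hL' : IsPartition L') (h : ∀ b ∈ L, b.HasShape p)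
    (h' : ∀ b ∈ L', b.HasShape p) : L.Perm L' := by
  have key : ∀ {L L' : List (Brick k r)}, IsPartition L' → (∀ b ∈ L, b.HasShape p) →
      (∀ b ∈ L', b.HasShape p) → ∀ b ∈ L, b ∈ L' := by
    intro L L' hL' h h' b hb
    obtain ⟨c, hc, hy⟩ := hL'.cover (b.pt fun _ _ => ⟨0, hk⟩)
    rwa [Brick.eq_of_length_eq (b.pt_mem _) hy fun s => (h b hb s).trans (h' c hc s).symm]
  exact (List.perm_ext_iff_of_nodup hL.nodup hL'.nodup).mpr fun b =>
    ⟨key hL' h h' b, key hL h' h b⟩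

/-- Two partitions have a common refinement. -/
theorem exists_common_refines (hk : 0 < k) {L L' : List (Brick k r)} (hL : IsPartition L)
    (hL' : IsPartition L') : ∃ X, Refines L X ∧ Refines L' X := by
  obtain ⟨p, hp⟩ := exists_shape_bound (L ++ L')
  obtain ⟨X, hX, hXp⟩ := exists_refines_hasShape p L fun b hb => hp b (List.mem_append_left _ hb)
  obtain ⟨X', hX', hXp'⟩ :=
    exists_refines_hasShape p L' fun b hb => hp b (List.mem_append_right _ hb)
  exact ⟨X, hX, hX'.trans (Refines.of_perm
    ((hX'.isPartition hL').perm_of_hasShape hk (hX.isPartition hL) hXp' hXp))⟩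

/-- `γ` maps the box of `b` to the box of `c` by the prefix substitution. -/
def Acts (γ : Equiv.Perm (Y 2 k r)) (b c : Brick k r) : Prop := ∀ x, γ (b.pt x) = c.pt x

theorem Acts.one (b : Brick k r) : Acts 1 b b := fun _ => rfl

theorem Acts.mul {γ δ : Equiv.Perm (Y 2 k r)} {b c d : Brick k r} (h : Acts γ c d)
    (h' : Acts δ b c) : Acts (γ * δ) b d := fun x => by
  rw [Equiv.Perm.mul_apply, h' x, h x]

theorem Acts.inv {γ : Equiv.Perm (Y 2 k r)} {b c : Brick k r} (h : Acts γ b c) :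
    Acts γ⁻¹ c b := fun x => by
  rw [← h x]; simp

theorem Acts.child {γ : Equiv.Perm (Y 2 k r)} {b c : Brick k r} (h : Acts γ b c) (s : Fin 2)
    (i : Fin k) : Acts γ (b.child s i) (c.child s i) := fun x => by
  rw [Brick.pt_child, h, Brick.pt_child]

theorem Acts.right_unique (hk : 2 ≤ k) {γ : Equiv.Perm (Y 2 k r)} {b c d : Brick k r}
    (h : Acts γ b c) (h' : Acts γ b d) : c = d :=
  Brick.eq_of_forall_pt_eq hk fun x => (h x).symm.trans (h' x)

theorem Acts.mem {γ : Equiv.Perm (Y 2 k r)} {b c : Brick k r} (h : Acts γ b c) {y : Y 2 k r}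
    (hy : y ∈ b.carrier) : γ y ∈ c.carrier := by
  obtain ⟨x, rfl⟩ := hy
  exact ⟨x, h x⟩

theorem Acts.mem_iff {γ : Equiv.Perm (Y 2 k r)} {b c : Brick k r} (h : Acts γ b c) {y : Y 2 k r} :
    γ y ∈ c.carrier ↔ y ∈ b.carrier := by
  refine ⟨fun hy => ?_, h.mem⟩
  simpa using h.inv.mem hy

theorem Acts.sep (hk : 0 < k) {γ : Equiv.Perm (Y 2 k r)} {b c b' c' : Brick k r} (hb : Acts γ b b')
    (hc : Acts γ c c') (h : Brick.Sep b c) : Brick.Sep b' c' :=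
  Brick.sep_of_forall_notMem hk fun _ h1 h2 => h.notMem (hb.inv.mem h1) (hc.inv.mem h2)

theorem eq_of_acts {γ δ : Equiv.Perm (Y 2 k r)} {L : List (Brick k r)} (hL : IsPartition L)
    (h : ∀ b ∈ L, ∃ c, Acts γ b c ∧ Acts δ b c) : γ = δ := by
  ext1 y
  obtain ⟨b, hb, x, rfl⟩ := hL.cover y
  obtain ⟨c, h1, h2⟩ := h b hb
  exact (h1 x).trans (h2 x).symm

/-- `γ` acts on the box of `b` by a prefix substitution. -/
def Nice (γ : Equiv.Perm (Y 2 k r)) (b : Brick k r) : Prop := ∃ c, Acts γ b c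

open Classical in
/-- The image of the box `b`, when `γ` acts on it by a prefix substitution. -/
noncomputable def img (γ : Equiv.Perm (Y 2 k r)) (b : Brick k r) : Brick k r :=
  if h : Nice γ b then h.choose else b

theorem Nice.acts {γ : Equiv.Perm (Y 2 k r)} {b : Brick k r} (h : Nice γ b) :
    Acts γ b (img γ b) := by
  rw [img, dif_pos h]
  exact h.choose_spec

theorem Acts.nice {γ : Equiv.Perm (Y 2 k r)} {b c : Brick k r} (h : Acts γ b c) : Nice γ b :=
  ⟨c, h⟩

theorem Acts.img_eq (hk : 2 ≤ k) {γ : Equiv.Perm (Y 2 k r)} {b c : Brick k r} (h : Acts γ b c) :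
    img γ b = c :=
  h.nice.acts.right_unique hk h

theorem Nice.child {γ : Equiv.Perm (Y 2 k r)} {b : Brick k r} (h : Nice γ b) (s : Fin 2)
    (i : Fin k) : Nice γ (b.child s i) := (h.acts.child s i).nice

theorem Nice.map_children (hk : 2 ≤ k) {γ : Equiv.Perm (Y 2 k r)} {b : Brick k r} (h : Nice γ b)
    (s : Fin 2) : (b.children s).map (img γ) = (img γ b).children s := by
  simp only [Brick.children, List.map_map]
  exact List.map_congr_left fun i _ => (h.acts.child s i).img_eq hk

theorem Move.nice {γ : Equiv.Perm (Y 2 k r)} {L L' : List (Brick k r)} (h : Move L L')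
    (hL : ∀ b ∈ L, Nice γ b) : ∀ b ∈ L', Nice γ b := by
  cases h with
  | perm hp => exact fun b hb => hL b (hp.mem_iff.mpr hb)
  | split s b R =>
    intro c hc
    rcases List.mem_append.mp hc with hc | hc
    · obtain ⟨i, rfl⟩ := Brick.mem_children.mp hc
      exact (hL b List.mem_cons_self).child s i
    · exact hL c (List.mem_cons_of_mem _ hc)

theorem Refines.nice {γ : Equiv.Perm (Y 2 k r)} {L L' : List (Brick k r)} (h : Refines L L')
    (hL : ∀ b ∈ L, Nice γ b) : ∀ b ∈ L', Nice γ b := by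
  induction h with
  | refl => exact hL
  | tail _ hm ih => exact hm.nice ih

theorem Move.map_img (hk : 2 ≤ k) {γ : Equiv.Perm (Y 2 k r)} {L L' : List (Brick k r)}
    (h : Move L L') (hL : ∀ b ∈ L, Nice γ b) : Move (L.map (img γ)) (L'.map (img γ)) := by
  cases h with
  | perm hp => exact .perm (hp.map _)
  | split s b R =>
    rw [List.map_append, (hL b List.mem_cons_self).map_children hk, List.map_cons]
    exact .split s _ _

theorem Refines.map_img (hk : 2 ≤ k) {γ : Equiv.Perm (Y 2 k r)} {L L' : List (Brick k r)}
    (h : Refines L L') (hL : ∀ b ∈ L, Nice γ b) : Refines (L.map (img γ)) (L'.map (img γ)) := by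
  induction h with
  | refl => exact .refl
  | tail h' hm ih => exact .tail ih (hm.map_img hk (Refines.nice h' hL))

theorem isPartition_map_img (hk : 0 < k) {γ : Equiv.Perm (Y 2 k r)} {L : List (Brick k r)}
    (hL : IsPartition L) (hγ : ∀ b ∈ L, Nice γ b) : IsPartition (L.map (img γ)) := by
  refine ⟨fun y => ?_, List.pairwise_map.mpr (hL.pairwise.imp_of_mem fun ha hb h =>
    (hγ _ ha).acts.sep hk (hγ _ hb).acts h)⟩
  obtain ⟨b, hb, hy⟩ := hL.cover (γ⁻¹ y)
  refine ⟨_, List.mem_map_of_mem hb, ?_⟩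
  simpa using (hγ b hb).acts.mem hy

/-- Given a nice partition `L` for `γ`, every refinement of the image partition is the image of a
refinement of `L`. -/
theorem Refines.exists_lift (hk : 2 ≤ k) {γ : Equiv.Perm (Y 2 k r)} {L X : List (Brick k r)}
    (hL : ∀ b ∈ L, Nice γ b) (h : Refines (L.map (img γ)) X) :
    ∃ L', Refines L L' ∧ L'.map (img γ) = X := by
  have hinv : ∀ b ∈ L, img γ⁻¹ (img γ b) = b := fun b hb => (hL b hb).acts.inv.img_eq hk
  have hnice : ∀ c ∈ L.map (img γ), Nice γ⁻¹ c := by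
    intro c hc
    obtain ⟨b, hb, rfl⟩ := List.mem_map.mp hc
    exact (hL b hb).acts.inv.nice
  refine ⟨X.map (img γ⁻¹), ?_, ?_⟩
  · have := h.map_img hk hnice
    rwa [List.map_map, List.map_congr_left (f := img γ⁻¹ ∘ img γ) (g := id) hinv,
      List.map_id] at this
  · rw [List.map_map, List.map_congr_left (g := id), List.map_id]
    intro c hc
    have := (h.nice hnice c hc).acts.inv
    rw [inv_inv] at this
    exact this.img_eq hk

theorem isElement_iff (hk : 2 ≤ k) {γ : Equiv.Perm (Y 2 k r)} :
    IsElement γ ↔ ∃ L : List (Brick k r), IsPartition L ∧ ∀ b ∈ L, Nice γ b := by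
  constructor
  · rintro ⟨m, u, v, a, b, h1, -, h3⟩
    refine ⟨List.ofFn fun t => ⟨u t, a t⟩, ⟨fun y => ?_, ?_⟩, ?_⟩
    · obtain ⟨t, ht, -⟩ := h1 y
      exact ⟨_, List.mem_ofFn.mpr ⟨t, rfl⟩, ht⟩
    · refine List.pairwise_ofFn.mpr fun i j hij => Brick.sep_of_forall_notMem (by omega) ?_
      intro y hi hj
      exact hij.ne ((h1 y).unique hi hj)
    · intro c hc
      obtain ⟨t, rfl⟩ := List.mem_ofFn.mp hc
      exact ⟨⟨v t, b t⟩, h3 t⟩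
  · rintro ⟨L, hL, hγ⟩
    have key : ∀ {L : List (Brick k r)}, IsPartition L → ∀ y, ∃! t : Fin L.length,
        y ∈ box L[t].word L[t].idx := by
      intro L hL y
      obtain ⟨b, hb, hy⟩ := hL.cover y
      obtain ⟨n, hn, rfl⟩ := List.getElem_of_mem hb
      refine ⟨⟨n, hn⟩, hy, fun t ht => ?_⟩
      by_contra hne
      rcases lt_or_gt_of_ne hne with hlt | hlt
      · exact (List.pairwise_iff_getElem.mp hL.pairwise t n t.2 hn hlt).notMem ht hy
      · exact (List.pairwise_iff_getElem.mp hL.pairwise n t hn t.2 hlt).notMem hy ht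
    refine ⟨L.length, fun t => L[t].word, fun t => (img γ L[t]).word, fun t => L[t].idx,
      fun t => (img γ L[t]).idx, key hL, fun y => ?_, fun t x => (hγ _ (List.getElem_mem _)).acts x⟩
    refine (existsUnique_congr fun t => ?_).mp (key hL (γ⁻¹ y))
    have := (hγ L[t] (List.getElem_mem _)).acts.mem_iff (y := γ⁻¹ y)
    rw [show γ (γ⁻¹ y) = y by simp] at this
    exact this.symm

/-- The relations between the two generators of the abelianization. -/
structure Relations (k : ℕ) {T : Type*} [AddCommGroup T] (t ε : T) : Prop where
  two_nsmul : 2 • ε = 0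
  nsmul_eps : k • ε = ε
  nsmul_tau : k • t = t + k.choose 2 • ε

section Relations

variable {T : Type*} [AddCommGroup T] {t ε : T}

theorem Relations.neg (h : Relations k t ε) : -ε = ε := by
  rw [neg_eq_iff_add_eq_zero, ← h.two_nsmul, _root_.two_nsmul]

theorem Relations.nsmul_congr (h : Relations k t ε) {m n : ℕ} (hmn : m % 2 = n % 2) :
    m • ε = n • ε := by
  have key : ∀ m, m • ε = (m % 2) • ε := fun m => by
    conv_lhs => rw [← Nat.mod_add_div m 2, add_nsmul, mul_comm, mul_nsmul', h.two_nsmul,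
      nsmul_zero, add_zero]
  rw [key m, key n, hmn]

theorem Relations.mul_nsmul_eps (h : Relations k t ε) (m : ℕ) : (k * m) • ε = m • ε := by
  rw [mul_comm, mul_nsmul', h.nsmul_eps]

theorem Relations.pred_nsmul (h : Relations k t ε) (hk : 1 ≤ k) : (k - 1) • ε = 0 := by
  have := h.nsmul_eps
  obtain ⟨m, rfl⟩ := Nat.exists_eq_add_of_le' hk
  rw [add_nsmul, one_nsmul, add_eq_right] at this
  simpa using this

end Relations

/-- The contribution of one place to the number of inversions, modulo `2`, between two boxes. -/
def inversionWeight (k : ℕ) : Option ℕ → Option ℕ → ℕ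
  | some x, some y => if y < x then 1 else 0
  | some x, none => x
  | none, some y => k - 1 - y
  | none, none => k.choose 2

open Classical in
/-- The number of inversions, modulo `2`, between two separated boxes with the given digits. -/
noncomputable def inversions (k : ℕ) (d e : ℕ → Option ℕ) : ℕ :=
  if h : ∃ n, Brick.Differ d e n then
    ∑ n ∈ Finset.range (Nat.find h + 1), inversionWeight k (d n) (e n)
  else 0

theorem inversions_eq {d e : ℕ → Option ℕ} {N : ℕ} (hN : Brick.Differ d e N)
    (hlt : ∀ n < N, ¬ Brick.Differ d e n) :
    inversions k d e = ∑ n ∈ Finset.range (N + 1), inversionWeight k (d n) (e n) := by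
  classical
  have h : ∃ n, Brick.Differ d e n := ⟨N, hN⟩
  rw [inversions, dif_pos h, (Nat.find_eq_iff h).mpr ⟨hN, hlt⟩]

theorem exists_first_differ {d e : ℕ → Option ℕ} (h : ∃ n, Brick.Differ d e n) :
    ∃ N, Brick.Differ d e N ∧ ∀ n < N, ¬ Brick.Differ d e n := by
  classical
  exact ⟨Nat.find h, Nat.find_spec h, fun n hn => Nat.find_min h hn⟩

theorem sum_range_split {M N : ℕ} (h : M < N + 1) (φ : ℕ → ℕ) :
    ∑ n ∈ Finset.range (N + 1), φ n =
      ∑ n ∈ Finset.range M, φ n + φ M + ∑ n ∈ Finset.Ico (M + 1) (N + 1), φ n := by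
  rw [← Finset.sum_range_succ, Finset.sum_range_add_sum_Ico _ h]

section

variable {T : Type*} [AddCommGroup T] {t ε : T}

theorem inversions_add_inversions (h : Relations k t ε) {d e : ℕ → Option ℕ}
    (hs : ∃ n, Brick.Differ d e n) (hd : ∀ n x, d n = some x → e n = none → x < k)
    (he : ∀ n x, e n = some x → d n = none → x < k) :
    inversions k d e • ε + inversions k e d • ε = ε := by
  obtain ⟨N, hN, hlt⟩ := exists_first_differ hs
  rw [inversions_eq hN hlt, inversions_eq hN.symm fun n hn h' => hlt n hn h'.symm, ← add_nsmul,
    ← Finset.sum_add_distrib, Finset.sum_range_succ, add_nsmul, Finset.sum_smul,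
    Finset.sum_eq_zero, zero_add]
  · obtain ⟨x, y, hx, hy, hxy⟩ := hN
    rw [hx, hy]
    rcases lt_or_gt_of_ne hxy with hlt | hlt <;>
      simp [inversionWeight, hlt, hlt.not_gt]
  · intro n hn
    rcases hx : d n with _ | x <;> rcases hy : e n with _ | y
    · simp only [inversionWeight]
      rw [← two_mul, mul_nsmul, h.two_nsmul, nsmul_zero]
    · have := he n y hy hx
      simp only [inversionWeight]
      rw [Nat.sub_add_cancel (by omega), h.pred_nsmul (by omega)]
    · have := hd n x hx hy
      simp only [inversionWeight]
      rw [Nat.add_sub_cancel' (by omega), h.pred_nsmul (by omega)]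
    · have : x = y := by
        by_contra hne
        exact hlt n (Finset.mem_range.mp hn) ⟨x, y, hx, hy, hne⟩
      simp [inversionWeight, this]

theorem sum_inversions_update (h : Relations k t ε) {d e : ℕ → Option ℕ}
    (hs : ∃ n, Brick.Differ d e n) {M : ℕ} (hM : d M = none) (hc : ∀ c, e M = some c → c < k) :
    (∑ i ∈ Finset.range k, inversions k (Function.update d M (some i)) e) • ε =
      inversions k d e • ε := by
  obtain ⟨N, hN, hlt⟩ := exists_first_differ hs
  have hNM : N ≠ M := by
    rintro rfl
    obtain ⟨x, y, hx, -⟩ := hN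
    simp [hM] at hx
  have hdiff : ∀ i n, n ≠ M →
      (Brick.Differ (Function.update d M (some i)) e n ↔ Brick.Differ d e n) := by
    intro i n hn
    simp only [Brick.Differ, Function.update_of_ne hn]
  rcases lt_or_gt_of_ne hNM with hlt' | hgt
  · rw [Finset.sum_congr rfl fun i _ => ?_, Finset.sum_const, Finset.card_range, smul_eq_mul,
      h.mul_nsmul_eps]
    rw [inversions_eq hN hlt, inversions_eq ((hdiff i N hNM).mpr hN)
      fun n hn => (hdiff i n (by omega)).not.mpr (hlt n hn)]
    refine Finset.sum_congr rfl fun n hn => ?_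
    rw [Function.update_of_ne]
    have := Finset.mem_range.mp hn
    omega
  · set P := ∑ n ∈ Finset.range M, inversionWeight k (d n) (e n) with hP
    set Q := ∑ n ∈ Finset.Ico (M + 1) (N + 1), inversionWeight k (d n) (e n) with hQ
    have hP' : ∀ i, ∑ n ∈ Finset.range M,
        inversionWeight k (Function.update d M (some i) n) (e n) = P := fun i =>
      Finset.sum_congr rfl fun n hn => by
        rw [Function.update_of_ne (Finset.mem_range.mp hn).ne]
    have hQ' : ∀ i, ∑ n ∈ Finset.Ico (M + 1) (N + 1),
        inversionWeight k (Function.update d M (some i) n) (e n) = Q := fun i =>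
      Finset.sum_congr rfl fun n hn => by
        have := Finset.mem_Ico.mp hn
        rw [Function.update_of_ne (by omega)]
    have hleft : inversions k d e = P + inversionWeight k none (e M) + Q := by
      rw [inversions_eq hN hlt, sum_range_split (by omega : M < N + 1), hM]
    have hright : ∀ i, (∀ c, e M = some c → c = i) →
        inversions k (Function.update d M (some i)) e =
          P + inversionWeight k (some i) (e M) + Q := by
      intro i hi
      rw [inversions_eq ((hdiff i N hNM).mpr hN), sum_range_split (by omega : M < N + 1),
        hP', hQ', Function.update_self]
      intro n hn
      by_cases hnM : n = M
      · subst hnM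
        rintro ⟨x, y, hx, hy, hxy⟩
        rw [Function.update_self, Option.some_inj] at hx
        exact hxy (hx ▸ (hi y hy).symm)
      · exact (hdiff i n hnM).not.mpr (hlt n hn)
    rcases hc' : e M with _ | c
    · rw [Finset.sum_congr rfl fun i _ => hright i (by simp [hc']), hleft, hc']
      simp only [inversionWeight]
      rw [Finset.sum_add_distrib, Finset.sum_add_distrib, Finset.sum_range_id, Nat.choose_two_right]
      simp only [Finset.sum_const, Finset.card_range, smul_eq_mul, add_nsmul, h.mul_nsmul_eps]
    · have hck := hc c hc'
      have hval : ∀ i ∈ Finset.range k, inversions k (Function.update d M (some i)) e =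
          P + (if c < i then 1 else 0) + if i = c then Q else 0 := by
        intro i _
        by_cases hi : i = c
        · subst hi
          rw [hright i (by simp [hc']), hc']
          simp [inversionWeight]
        · rw [if_neg hi, add_zero, inversions_eq (N := M)
            ⟨i, c, by simp, hc', hi⟩ fun n hn => (hdiff i n hn.ne).not.mpr (hlt n (by omega)),
            Finset.sum_range_succ, hP', Function.update_self, hc']
          rfl
      have hcard : ∑ i ∈ Finset.range k, (if c < i then 1 else 0) = k - 1 - c := by
        rw [← Finset.card_filter]
        have : Finset.filter (fun i => c < i) (Finset.range k) = Finset.Ico (c + 1) k := by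
          ext i; simp; omega
        rw [this, Nat.card_Ico]; omega
      rw [Finset.sum_congr rfl hval, hleft, hc', Finset.sum_add_distrib, Finset.sum_add_distrib,
        hcard, Finset.sum_ite_eq', if_pos (Finset.mem_range.mpr hck)]
      simp only [Finset.sum_const, Finset.card_range, smul_eq_mul, add_nsmul, h.mul_nsmul_eps,
        inversionWeight]

end

namespace Brick

theorem digit_lt {b c : Brick k r} {n x : ℕ} (hx : b.digit n = some x) (hc : c.digit n = none) :
    x < k := by
  rcases n with _ | n
  · simp [digit] at hc
  · simp only [digit, Option.map_eq_some_iff] at hx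
    obtain ⟨d, -, rfl⟩ := hx
    exact d.2

/-- The number of inversions, modulo `2`, between two separated boxes. -/
noncomputable def inv (b c : Brick k r) : ℕ := inversions k b.digit c.digit

theorem sum_range_two_mul_add_one (φ : ℕ → ℕ) (m : ℕ) :
    ∑ n ∈ Finset.range (2 * m + 1), φ n =
      φ 0 + ∑ l ∈ Finset.range m, (φ (place 0 l) + φ (place 1 l)) := by
  induction m with
  | zero => simp
  | succ m ih =>
    rw [show 2 * (m + 1) + 1 = 2 * m + 1 + 1 + 1 by ring, Finset.sum_range_succ,
      Finset.sum_range_succ, ih, Finset.sum_range_succ]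
    simp only [place, Fin.val_zero, Fin.val_one]
    ring_nf

theorem inversionWeight_digit_self (b : Brick k r) (s : Fin 2) (l : ℕ) :
    inversionWeight k (b.digit (place s l)) (b.digit (place s l)) =
      if l < (b.word s).length then 0 else k.choose 2 := by
  rw [digit_place]
  split_ifs with hl
  · simp [List.getElem?_eq_getElem hl, inversionWeight]
  · simp [List.getElem?_eq_none (not_lt.mp hl), inversionWeight]

/-- The number of unknown digits before the first unknown digit in direction `s`. -/
def gap (s : Fin 2) (b : Brick k r) : ℕ :=
  if s = 0 then (b.word 0).length - (b.word 1).length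
  else (b.word 1).length + 1 - (b.word 0).length

theorem sum_ite_lt_of_le (c m n : ℕ) :
    ∑ l ∈ Finset.range m, (if l < n then 0 else c) = (m - n) * c := by
  rw [Finset.sum_ite, Finset.sum_const_zero, zero_add, Finset.sum_const, smul_eq_mul]
  congr 1
  have : Finset.filter (fun l => ¬ l < n) (Finset.range m) = Finset.Ico n m := by
    ext; simp; omega
  rw [this, Nat.card_Ico]

theorem inv_child_child (s : Fin 2) {i j : Fin k} (hij : i < j) (b : Brick k r) :
    inv (b.child s i) (b.child s j) = gap s b * k.choose 2 := by
  have hval : inv (b.child s i) (b.child s j) = ∑ n ∈ Finset.range (place s (b.word s).length),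
      inversionWeight k (b.digit n) (b.digit n) := by
    rw [inv, digit_child, digit_child, inversions_eq (N := place s (b.word s).length)
      ⟨i, j, by simp, by simp, fun h' => hij.ne (Fin.ext h')⟩, Finset.sum_range_succ]
    · rw [Function.update_self, Function.update_self]
      simp only [inversionWeight]
      rw [if_neg (not_lt.mpr (Fin.le_def.mp hij.le)), add_zero]
      refine Finset.sum_congr rfl fun n hn => ?_
      rw [Function.update_of_ne (Finset.mem_range.mp hn).ne,
        Function.update_of_ne (Finset.mem_range.mp hn).ne]
    · rintro n hn ⟨x, y, hx, hy, hxy⟩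
      rw [Function.update_of_ne hn.ne] at hx hy
      exact hxy (Option.some_inj.mp (hx.symm.trans hy))
  rw [hval]
  have h0 : inversionWeight k (b.digit 0) (b.digit 0) = 0 := by simp [digit, inversionWeight]
  fin_cases s
  · simp only [Fin.zero_eta, gap, if_true]
    rw [show place 0 (b.word 0).length = 2 * (b.word 0).length + 1 by simp [place],
      sum_range_two_mul_add_one, h0, zero_add]
    simp only [inversionWeight_digit_self]
    rw [Finset.sum_add_distrib, sum_ite_lt_of_le, sum_ite_lt_of_le]
    simp
  · simp only [Fin.mk_one, gap, one_ne_zero, if_false]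
    rw [show place 1 (b.word 1).length = 2 * (b.word 1).length + 1 + 1 by simp [place],
      Finset.sum_range_succ, sum_range_two_mul_add_one, h0, zero_add,
      show 2 * (b.word 1).length + 1 = place 0 (b.word 1).length by simp [place]]
    simp only [inversionWeight_digit_self]
    rw [Finset.sum_add_distrib, sum_ite_lt_of_le _ _ (b.word 1).length, add_right_comm,
      ← Finset.sum_range_succ (fun l => if l < (b.word 0).length then 0 else k.choose 2),
      sum_ite_lt_of_le]
    simp

section

variable {T : Type*} [AddCommGroup T] {t ε : T}

theorem inv_add_inv (h : Relations k t ε) {b c : Brick k r} (hs : Sep b c) :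
    inv b c • ε + inv c b • ε = ε :=
  inversions_add_inversions h hs (fun _ _ => digit_lt) fun _ _ => digit_lt

theorem sum_inv_children_left (h : Relations k t ε) (s : Fin 2) {b c : Brick k r} (hs : Sep b c) :
    ((b.children s).map fun b' => inv b' c • ε).sum = inv b c • ε := by
  rw [inv, ← sum_inversions_update h hs (b.digit_place_length s)
    fun x hx => digit_lt hx (b.digit_place_length s), Finset.sum_smul, Finset.sum_range,
    ← List.sum_ofFn, children, List.map_map, List.ofFn_eq_map]
  simp only [Function.comp_def, inv, digit_child]

/-- The weight of a single box. -/
def weight (t ε : T) (b : Brick k r) : T :=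
  -((b.word 1).length • t) +
    (k.choose 2 * ∑ j ∈ Finset.range (b.word 0).length, max j (b.word 1).length) • ε

theorem nsmul_weight_aux (h : Relations k t ε) (n m m' l : ℕ)
    (hm : (n * k.choose 2 + m + l) % 2 = m' % 2) :
    k • (-(n • t) + m • ε) + l • ε = -(n • t) + m' • ε := by
  rw [← h.nsmul_congr hm, nsmul_add, smul_neg, smul_comm k n t, h.nsmul_tau, nsmul_add, neg_add,
    ← mul_nsmul', ← mul_nsmul', h.mul_nsmul_eps, ← smul_neg _ ε, h.neg, add_nsmul, add_nsmul]
  abel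

theorem nsmul_weight_child (h : Relations k t ε) (s : Fin 2) (i : Fin k) (b : Brick k r) :
    k • weight t ε (b.child s i) + (k.choose 2 * (gap s b * k.choose 2)) • ε =
      weight t ε b - if s = 1 then t else 0 := by
  have two : (2 : ZMod 2) = 0 := rfl
  have sq : (k.choose 2 : ZMod 2) * k.choose 2 = k.choose 2 := by
    generalize (k.choose 2 : ZMod 2) = c
    revert c
    decide
  rcases (by omega : s = 0 ∨ s = 1) with rfl | rfl
  · have hmax : ((b.word 1).length + gap 0 b : ℕ) = max (b.word 0).length (b.word 1).length := by
      simp only [gap, if_true]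
      omega
    have hmax' := congrArg (Nat.cast (R := ZMod 2)) hmax
    push_cast at hmax'
    rw [if_neg (by decide), sub_zero, weight, weight, word_child_self,
      word_child_of_ne (by decide), List.length_append, List.length_singleton,
      Finset.sum_range_succ, nsmul_weight_aux h]
    rw [← ZMod.natCast_eq_natCast_iff']
    push_cast
    linear_combination (b.word 1).length * k.choose 2 * two + gap 0 b * sq +
      gap 0 b * k.choose 2 * two - k.choose 2 * hmax'
  · have hsum : ∀ m n, ∑ j ∈ Finset.range m, max j (n + 1) =
        ∑ j ∈ Finset.range m, max j n + min m (n + 1) := by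
      intro m n
      induction m with
      | zero => simp
      | succ m ih =>
        rw [Finset.sum_range_succ, Finset.sum_range_succ, ih]
        omega
    have hmin : min (b.word 0).length ((b.word 1).length + 1) + gap 1 b =
        (b.word 1).length + 1 := by
      simp only [gap, one_ne_zero, if_false]
      omega
    have hmin' := congrArg (Nat.cast (R := ZMod 2)) hmin
    push_cast at hmin'
    rw [if_pos rfl, weight, weight, word_child_self, word_child_of_ne (by decide),
      List.length_append, List.length_singleton, nsmul_weight_aux h _ _
        (k.choose 2 * ∑ j ∈ Finset.range (b.word 0).length, max j (b.word 1).length),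
      add_nsmul, one_nsmul]
    · abel
    · rw [← ZMod.natCast_eq_natCast_iff', hsum]
      push_cast
      linear_combination k.choose 2 * hmin' + gap 1 b * sq +
        k.choose 2 * ((b.word 1).length + 1) * two

/-- The weight of a list of boxes, which determines the class of an element in the
abelianization. -/
noncomputable def listWeight (t ε : T) : List (Brick k r) → T
  | [] => 0
  | b :: L => weight t ε b + (L.map fun c => inv b c • ε).sum + listWeight t ε L

theorem listWeight_append (L L' : List (Brick k r)) :
    listWeight t ε (L ++ L') = listWeight t ε L + listWeight t ε L' +
      (L.map fun b => (L'.map fun c => inv b c • ε).sum).sum := by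
  induction L with
  | nil => simp [listWeight]
  | cons b L ih =>
    simp only [List.cons_append, listWeight, ih, List.map_append, List.sum_append, List.map_cons,
      List.sum_cons]
    abel

theorem listWeight_map_child (s : Fin 2) (b : Brick k r) (w : T)
    (hw : ∀ i, weight t ε (b.child s i) = w) (l : List (Fin k)) (hl : l.Pairwise (· < ·)) :
    listWeight t ε (l.map fun i => b.child s i) =
      l.length • w + (l.length.choose 2 * (gap s b * k.choose 2)) • ε := by
  induction l with
  | nil => simp [listWeight]
  | cons i l ih =>
    obtain ⟨h1, h2⟩ := List.pairwise_cons.mp hl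
    have h3 : ((l.map fun i => b.child s i).map fun c => inv (b.child s i) c • ε).sum =
        l.length • (gap s b * k.choose 2) • ε := by
      rw [List.map_map, List.map_congr_left (g := fun _ => (gap s b * k.choose 2) • ε)
        fun j hj => by rw [Function.comp_apply, inv_child_child s (h1 j hj)]]
      simp
    rw [List.map_cons, listWeight, hw, h3, ih h2, List.length_cons, Nat.choose_succ_succ',
      Nat.choose_one_right, add_mul, add_nsmul, add_nsmul, one_nsmul, mul_nsmul' ε l.length]
    abel

theorem listWeight_children (h : Relations k t ε) (s : Fin 2) (b : Brick k r) :
    listWeight t ε (b.children s) = weight t ε b - if s = 1 then t else 0 := by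
  rcases Nat.eq_zero_or_pos k with hk | hk
  · subst hk
    have h1 : b.children s = [] := by simp [children]
    have h2 := h.nsmul_eps
    have h3 := h.nsmul_tau
    simp only [zero_nsmul] at h2 h3
    simp only [← h2, nsmul_zero, add_zero] at h3
    simp [h1, listWeight, weight, ← h2, ← h3]
  · rw [children, listWeight_map_child s b (weight t ε (b.child s ⟨0, hk⟩)) _ _
      (List.pairwise_lt_finRange k), List.length_finRange, nsmul_weight_child h]
    intro i
    fin_cases s <;> simp [weight, child]

theorem listWeight_split (h : Relations k t ε) (s : Fin 2) (b : Brick k r) (R : List (Brick k r))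
    (hR : ∀ c ∈ R, Sep b c) :
    listWeight t ε (b.children s ++ R) = listWeight t ε (b :: R) - if s = 1 then t else 0 := by
  have h1 : ((b.children s).map fun b' => (R.map fun c => inv b' c • ε).sum).sum =
      (R.map fun c => inv b c • ε).sum := by
    induction R with
    | nil => simp
    | cons c R ih =>
      simp only [List.map_cons, List.sum_cons]
      rw [List.sum_map_add, ih fun c hc => hR c (List.mem_cons_of_mem _ hc),
        sum_inv_children_left h s (hR c List.mem_cons_self)]
  rw [listWeight_append, h1, listWeight_children h, listWeight]
  abel

theorem listWeight_swap (h : Relations k t ε) {b c : Brick k r} (hs : Sep b c)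
    (R : List (Brick k r)) :
    listWeight t ε (c :: b :: R) = listWeight t ε (b :: c :: R) + ε := by
  have h1 := inv_add_inv h hs
  have h2 : inv c b • ε = inv b c • ε + ε := by
    nth_rw 3 [← h1]
    rw [← add_assoc, ← two_nsmul, ← mul_nsmul, mul_nsmul', h.two_nsmul]
    simp
  simp only [listWeight, List.map_cons, List.sum_cons, h2]
  abel

/-- The change of weight under `γ`. -/
noncomputable def weightChange (t ε : T) (γ : Equiv.Perm (Y 2 k r)) (L : List (Brick k r)) : T :=
  listWeight t ε L - listWeight t ε (L.map (img γ))

theorem weightChange_perm (hk : 2 ≤ k) (h : Relations k t ε) {γ : Equiv.Perm (Y 2 k r)}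
    {L L' : List (Brick k r)} (hp : L.Perm L') (hL : L.Pairwise Sep) (hγ : ∀ b ∈ L, Nice γ b) :
    weightChange t ε γ L = weightChange t ε γ L' := by
  induction hp with
  | nil => rfl
  | @cons b L L' hp ih =>
    have := ih (List.pairwise_cons.mp hL).2 fun c hc => hγ c (List.mem_cons_of_mem _ hc)
    rw [weightChange, weightChange, sub_eq_iff_eq_add] at this
    simp only [weightChange, List.map_cons, listWeight]
    rw [((hp.map (img γ)).map _).sum_eq, (hp.map _).sum_eq, this]
    abel
  | swap b c R =>
    obtain ⟨h1, -⟩ := List.pairwise_cons.mp hL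
    have hcb := h1 b List.mem_cons_self
    have hcb' := (hγ c List.mem_cons_self).acts.sep (by omega)
      (hγ b (List.mem_cons_of_mem _ List.mem_cons_self)).acts hcb
    simp only [weightChange, List.map_cons]
    rw [listWeight_swap h hcb, listWeight_swap h hcb']
    abel
  | trans hp1 hp2 ih1 ih2 =>
    exact (ih1 hL hγ).trans (ih2 ((hp1.pairwise_iff Sep.symm).mp hL) fun b hb =>
      hγ b (hp1.mem_iff.mpr hb))

theorem weightChange_move (hk : 2 ≤ k) (h : Relations k t ε) {γ : Equiv.Perm (Y 2 k r)}
    {L L' : List (Brick k r)} (hm : Move L L') (hL : IsPartition L) (hγ : ∀ b ∈ L, Nice γ b) :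
    weightChange t ε γ L = weightChange t ε γ L' := by
  cases hm with
  | perm hp => exact weightChange_perm hk h hp hL.pairwise hγ
  | split s b R =>
    have hsep := (List.pairwise_cons.mp hL.pairwise).1
    have hb := hγ b List.mem_cons_self
    rw [weightChange, weightChange, List.map_append, hb.map_children hk,
      listWeight_split h s b R hsep, listWeight_split h s, List.map_cons]
    · abel
    · intro c hc
      obtain ⟨c', hc', rfl⟩ := List.mem_map.mp hc
      exact hb.acts.sep (by omega) (hγ c' (List.mem_cons_of_mem _ hc')).acts (hsep c' hc')

theorem weightChange_refines (hk : 2 ≤ k) (h : Relations k t ε) {γ : Equiv.Perm (Y 2 k r)}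
    {L L' : List (Brick k r)} (hr : Refines L L') (hL : IsPartition L) (hγ : ∀ b ∈ L, Nice γ b) :
    weightChange t ε γ L = weightChange t ε γ L' := by
  induction hr with
  | refl => rfl
  | tail hr hm ih =>
    exact ih.trans (weightChange_move hk h hm (Refines.isPartition hr hL) (Refines.nice hr hγ))

theorem weightChange_eq (hk : 2 ≤ k) (h : Relations k t ε) {γ : Equiv.Perm (Y 2 k r)}
    {L L' : List (Brick k r)} (hL : IsPartition L) (hγ : ∀ b ∈ L, Nice γ b)
    (hL' : IsPartition L') (hγ' : ∀ b ∈ L', Nice γ b) :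
    weightChange t ε γ L = weightChange t ε γ L' := by
  obtain ⟨X, h1, h2⟩ := exists_common_refines (by omega) hL hL'
  rw [weightChange_refines hk h h1 hL hγ, weightChange_refines hk h h2 hL' hγ']

end
end Brick

open Brick

/-- The weight homomorphism on the higher dimensional Thompson group. -/
theorem exists_weightHom (hk : 2 ≤ k) {T : Type*} [AddCommGroup T] {t ε : T}
    (h : Relations k t ε) (G : Subgroup (Equiv.Perm (Y 2 k r)))
    (hG : ∀ γ ∈ G, IsElement γ) :
    ∃ f : G →* Multiplicative T, ∀ (γ : G) (L : List (Brick k r)), IsPartition L →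
      (∀ b ∈ L, Nice γ.1 b) → f γ = Multiplicative.ofAdd (weightChange t ε γ.1 L) := by
  choose Λ hΛ hΛ' using fun γ : G => (isElement_iff hk).mp (hG γ.1 γ.2)
  have key : ∀ (γ : G) (L : List (Brick k r)), IsPartition L → (∀ b ∈ L, Nice γ.1 b) →
      weightChange t ε γ.1 (Λ γ) = weightChange t ε γ.1 L := fun γ L hL hγ =>
    weightChange_eq hk h (hΛ γ) (hΛ' γ) hL hγ
  refine ⟨MonoidHom.mk' (fun γ => Multiplicative.ofAdd (weightChange t ε γ.1 (Λ γ)))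
    fun γ δ => ?_, fun γ L hL hγ => congrArg Multiplicative.ofAdd (key γ L hL hγ)⟩
  rw [← ofAdd_add]
  obtain ⟨X, h1, h2⟩ := exists_common_refines (by omega)
    (isPartition_map_img (by omega) (hΛ δ) (hΛ' δ)) (hΛ γ)
  obtain ⟨L, hL, rfl⟩ := Refines.exists_lift hk (hΛ' δ) h1
  have hδL := Refines.nice hL (hΛ' δ)
  have hγX := Refines.nice h2 (hΛ' γ)
  have hLp := Refines.isPartition hL (hΛ δ)
  have hact : ∀ b ∈ L, Acts (γ * δ : G).1 b (img γ.1 (img δ.1 b)) := fun b hb =>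
    (hγX _ (List.mem_map_of_mem hb)).acts.mul (hδL b hb).acts
  rw [key (γ * δ) L hLp fun b hb => (hact b hb).nice, key δ L hLp hδL,
    key γ _ (Refines.isPartition h2 (hΛ γ)) hγX, weightChange, weightChange, weightChange,
    List.map_map, List.map_congr_left fun b hb => (hact b hb).img_eq hk]
  congr 1
  simp only [Function.comp_def]
  abel

theorem Acts.children {γ : Equiv.Perm (Y 2 k r)} {b c : Brick k r} (h : Acts γ b c) (s : Fin 2) :
    List.Forall₂ (Acts γ) (b.children s) (c.children s) := by
  rw [Brick.children, Brick.children, List.forall₂_map_left_iff, List.forall₂_map_right_iff,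
    List.forall₂_same]
  exact fun i _ => h.child s i

theorem Acts.of_fixed {γ : Equiv.Perm (Y 2 k r)} {b : Brick k r}
    (h : ∀ y ∈ b.carrier, γ y = y) : Acts γ b b := fun x => h _ (b.pt_mem x)

theorem Acts.apply_eq {γ : Equiv.Perm (Y 2 k r)} {b : Brick k r} (h : Acts γ b b) {y : Y 2 k r}
    (hy : y ∈ b.carrier) : γ y = y := by
  obtain ⟨x, rfl⟩ := hy
  exact h x

theorem IsPartition.bijective {L : List (Brick k r)} (hL : IsPartition L) :
    Function.Bijective fun p : Fin L.length × (Fin 2 → Cantor k) => L[p.1].pt p.2 := by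
  constructor
  · rintro ⟨i, x⟩ ⟨j, z⟩ h
    have hij : i = j := by
      by_contra hne
      have hsep : Sep L[i] L[j] := by
        rcases lt_or_gt_of_ne hne with hlt | hlt
        · exact List.pairwise_iff_getElem.mp hL.pairwise _ _ i.2 j.2 hlt
        · exact (List.pairwise_iff_getElem.mp hL.pairwise _ _ j.2 i.2 hlt).symm
      exact hsep.notMem (pt_mem _ x) (by simpa only [h] using pt_mem L[j] z)
    subst hij
    simpa using (L[i]).pt_injective h
  · intro y
    obtain ⟨b, hb, x, hx⟩ := hL.cover y
    obtain ⟨n, hn, rfl⟩ := List.getElem_of_mem hb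
    exact ⟨(⟨n, hn⟩, x), hx.symm⟩

theorem exists_forall₂_acts (hk : 2 ≤ k) {L L' : List (Brick k r)} (hL : IsPartition L)
    (hL' : IsPartition L') (hlen : L.length = L'.length) :
    ∃ γ : Equiv.Perm (Y 2 k r), IsElement γ ∧ List.Forall₂ (Acts γ) L L' := by
  set γ := (Equiv.ofBijective _ hL.bijective).symm.trans
    (((finCongr hlen).prodCongr (Equiv.refl _)).trans (Equiv.ofBijective _ hL'.bijective)) with hγ
  have key : List.Forall₂ (Acts γ) L L' := by
    refine List.forall₂_iff_get.mpr ⟨hlen, fun i h h' x => ?_⟩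
    have : (Equiv.ofBijective _ hL.bijective).symm (L[i].pt x) = (⟨i, h⟩, x) :=
      (Equiv.symm_apply_eq _).mpr rfl
    rw [hγ, Equiv.trans_apply, List.get_eq_getElem, this]
    rfl
  refine ⟨γ, (isElement_iff hk).mpr ⟨L, hL, fun b hb => ?_⟩, key⟩
  obtain ⟨n, hn, rfl⟩ := List.getElem_of_mem hb
  exact ⟨_, (List.forall₂_iff_get.mp key).2 n hn (hlen ▸ hn)⟩

theorem eq_of_forall₂_acts {γ δ : Equiv.Perm (Y 2 k r)} {L L' : List (Brick k r)}
    (hL : IsPartition L) (h : List.Forall₂ (Acts γ) L L') (h' : List.Forall₂ (Acts δ) L L') :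
    γ = δ := by
  refine eq_of_acts hL fun b hb => ?_
  obtain ⟨n, hn, rfl⟩ := List.getElem_of_mem hb
  have hn' := h.length_eq ▸ hn
  exact ⟨L'[n], (List.forall₂_iff_get.mp h).2 n hn hn', (List.forall₂_iff_get.mp h').2 n hn hn'⟩

theorem IsPartition.exists_append (hk : 2 ≤ k) {K R : List (Brick k r)}
    (h : IsPartition (K ++ R)) (hR : R ≠ []) (n : ℕ) :
    ∃ R', R' ≠ [] ∧ IsPartition (K ++ R') ∧ R'.length + n = R.length + n * k := by
  induction n with
  | zero => exact ⟨R, hR, h, by simp⟩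
  | succ n ih =>
    obtain ⟨R', hR', hp, hlen⟩ := ih
    obtain ⟨b, R', rfl⟩ := List.exists_cons_of_ne_nil hR'
    refine ⟨b.children 0 ++ R', ?_, ?_, ?_⟩
    · intro h0
      have := congrArg List.length h0
      simp at this
      omega
    · refine (IsPartition.split (s := 0) (hp.perm (List.perm_middle))).perm ?_
      rw [← List.append_assoc, ← List.append_assoc]
      exact List.perm_append_comm.append_right _
    · simp only [List.length_append, length_children, List.length_cons] at hlen ⊢
      linarith

/-- `K` extends to a partition by a nonempty list of boxes. -/
def Fits (K : List (Brick k r)) : Prop := ∃ R, R ≠ [] ∧ IsPartition (K ++ R)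

theorem exists_acts_of_fits (hk : 2 ≤ k) {K K' : List (Brick k r)} (h : Fits K) (h' : Fits K')
    (hlen : K.length = K'.length) :
    ∃ δ : Equiv.Perm (Y 2 k r), IsElement δ ∧ List.Forall₂ (Acts δ) K K' := by
  obtain ⟨R, hR, hp⟩ := h
  obtain ⟨R', hR', hp'⟩ := h'
  obtain ⟨X, h1, h2⟩ := exists_common_refines (by omega) hp hp'
  obtain ⟨n, hn⟩ := Refines.exists_length_eq h1
  obtain ⟨n', hn'⟩ := Refines.exists_length_eq h2
  obtain ⟨S, -, hS, hSl⟩ := hp.exists_append hk hR n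
  obtain ⟨S', -, hS', hSl'⟩ := hp'.exists_append hk hR' n'
  obtain ⟨δ, hδ, hF⟩ := exists_forall₂_acts hk hS hS' (by
    simp only [List.length_append] at *
    omega)
  refine ⟨δ, hδ, ?_⟩
  have := List.forall₂_take K.length hF
  rwa [List.take_left, hlen, List.take_left] at this

/-- `γ` exchanges the boxes `b` and `c` and fixes everything else. -/
structure IsSwap (γ : Equiv.Perm (Y 2 k r)) (b c : Brick k r) : Prop where
  left : Acts γ b c
  right : Acts γ c b
  fixed : ∀ y, y ∉ b.carrier → y ∉ c.carrier → γ y = y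

/-- `γ` exchanges the two directions of the first cut of the box `b` and fixes everything else. -/
structure IsTwist (γ : Equiv.Perm (Y 2 k r)) (b : Brick k r) : Prop where
  acts : ∀ i, Acts γ (b.child 0 i) (b.child 1 i)
  fixed : ∀ y, y ∉ b.carrier → γ y = y

theorem Acts.conj {γ δ : Equiv.Perm (Y 2 k r)} {b c b' c' : Brick k r} (h : Acts γ b c)
    (hb : Acts δ b b') (hc : Acts δ c c') : Acts (δ * γ * δ⁻¹) b' c' :=
  (hc.mul h).mul hb.inv

theorem IsSwap.eq_conj {γ γ' δ : Equiv.Perm (Y 2 k r)} {b c b' c' : Brick k r}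
    (h : IsSwap γ b c) (h' : IsSwap γ' b' c') (hb : Acts δ b b') (hc : Acts δ c c') :
    γ' = δ * γ * δ⁻¹ := by
  ext1 y
  by_cases h1 : y ∈ b'.carrier
  · obtain ⟨x, rfl⟩ := h1
    exact (h'.left x).trans (h.left.conj hb hc x).symm
  by_cases h2 : y ∈ c'.carrier
  · obtain ⟨x, rfl⟩ := h2
    exact (h'.right x).trans (h.right.conj hc hb x).symm
  have := h.fixed (δ⁻¹ y) (by rwa [hb.inv.mem_iff]) (by rwa [hc.inv.mem_iff])
  rw [h'.fixed y h1 h2, Equiv.Perm.mul_apply, Equiv.Perm.mul_apply, this]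
  simp

theorem IsTwist.eq_conj {γ γ' δ : Equiv.Perm (Y 2 k r)} {b b' : Brick k r}
    (h : IsTwist γ b) (h' : IsTwist γ' b') (hb : Acts δ b b') : γ' = δ * γ * δ⁻¹ := by
  ext1 y
  by_cases h1 : y ∈ b'.carrier
  · obtain ⟨i, x, rfl⟩ := exists_mem_child (s := 0) h1
    exact (h'.acts i x).trans ((h.acts i).conj (hb.child 0 i) (hb.child 1 i) x).symm
  have := h.fixed (δ⁻¹ y) (by rwa [hb.inv.mem_iff])
  rw [h'.fixed y h1, Equiv.Perm.mul_apply, Equiv.Perm.mul_apply, this]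
  simp

theorem IsPartition.apply_eq_of_forall_acts {γ : Equiv.Perm (Y 2 k r)} {K R : List (Brick k r)}
    (h : IsPartition (K ++ R)) (hR : ∀ c ∈ R, Acts γ c c) {y : Y 2 k r}
    (hy : ∀ b ∈ K, y ∉ b.carrier) : γ y = y := by
  obtain ⟨b, hb, hby⟩ := h.cover y
  rcases List.mem_append.mp hb with hb | hb
  · exact absurd hby (hy b hb)
  · exact (hR b hb).apply_eq hby

theorem forall₂_append_inv {α β : Type*} {Q : α → β → Prop} {A R : List α} {B S : List β}
    (hlen : A.length = B.length) (h : List.Forall₂ Q (A ++ R) (B ++ S)) :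
    List.Forall₂ Q A B ∧ List.Forall₂ Q R S := by
  have h1 := List.forall₂_take A.length h
  have h2 := List.forall₂_drop A.length h
  rw [List.take_left, hlen, List.take_left] at h1
  rw [List.drop_left, hlen, List.drop_left] at h2
  exact ⟨h1, h2⟩

theorem exists_isSwap (hk : 2 ≤ k) {b c : Brick k r} {R : List (Brick k r)}
    (h : IsPartition ([b, c] ++ R)) : ∃ γ, IsElement γ ∧ IsSwap γ b c := by
  obtain ⟨γ, hγ, hF⟩ := exists_forall₂_acts hk h (h.perm (List.Perm.swap c b R)) rfl
  simp only [List.cons_append, List.nil_append, List.forall₂_cons, List.forall₂_same] at hF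
  obtain ⟨h1, h2, h3⟩ := hF
  exact ⟨γ, hγ, h1, h2, fun y hb hc => h.apply_eq_of_forall_acts h3 (by simp [hb, hc])⟩

theorem exists_isTwist (hk : 2 ≤ k) {b : Brick k r} {R : List (Brick k r)}
    (h : IsPartition ([b] ++ R)) : ∃ γ, IsElement γ ∧ IsTwist γ b := by
  obtain ⟨γ, hγ, hF⟩ := exists_forall₂_acts hk (h.split (s := 0)) (h.split (s := 1)) (by simp)
  obtain ⟨h1, h2⟩ := forall₂_append_inv (by simp) hF
  rw [Brick.children, Brick.children, List.forall₂_map_left_iff, List.forall₂_map_right_iff,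
    List.forall₂_same] at h1
  exact ⟨γ, hγ, fun i => h1 i (List.mem_finRange i), fun y hb =>
    h.apply_eq_of_forall_acts (List.forall₂_same.mp h2) (by simp [hb])⟩

section Classes

variable {G : Subgroup (Equiv.Perm (Y 2 k r))} {A : Type*} [CommGroup A] {q : G →* A} {t e : A}

/-- The values `e` and `t` of `q` on the exchanges and on the twists. -/
structure Classes (q : G →* A) (t e : A) : Prop where
  swap : ∀ (γ : G) (b c : Brick k r), Fits [b, c] → IsSwap γ.1 b c → q γ = e
  twist : ∀ (γ : G) (b : Brick k r), Fits [b] → IsTwist γ.1 b → q γ = t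

theorem map_conj (q : G →* A) (γ δ : G) : q (δ * γ * δ⁻¹) = q γ := by
  rw [map_mul, map_mul, map_inv, mul_comm, inv_mul_cancel_left]

theorem classes_of_isSwap_of_isTwist (hk : 2 ≤ k) (hG : ∀ γ, IsElement γ → γ ∈ G) (q : G →* A)
    {σ τ : G} {b c d : Brick k r} (hbc : Fits [b, c]) (hd : Fits [d]) (hσ : IsSwap σ.1 b c)
    (hτ : IsTwist τ.1 d) : Classes q (q τ) (q σ) := by
  constructor
  · intro γ b' c' h' hγ
    obtain ⟨δ, hδ, hF⟩ := exists_acts_of_fits hk hbc h' rfl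
    simp only [List.forall₂_cons] at hF
    have : γ = ⟨δ, hG δ hδ⟩ * σ * ⟨δ, hG δ hδ⟩⁻¹ :=
      Subtype.ext (hσ.eq_conj hγ hF.1 hF.2.1)
    rw [this, map_conj]
  · intro γ b' h' hγ
    obtain ⟨δ, hδ, hF⟩ := exists_acts_of_fits hk hd h' rfl
    simp only [List.forall₂_cons] at hF
    have : γ = ⟨δ, hG δ hδ⟩ * τ * ⟨δ, hG δ hδ⟩⁻¹ := Subtype.ext (hτ.eq_conj hγ hF.1)
    rw [this, map_conj]

/-- Every point lies in exactly one box of the family. -/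
def Tiles {ι : Type*} (P : ι → Brick k r) : Prop := ∀ y, ∃! i, y ∈ (P i).carrier

theorem Tiles.isPartition (hk : 0 < k) {ι : Type*} {P : ι → Brick k r} (h : Tiles P)
    {l : List ι} (hl : l.Nodup) (hm : ∀ i, i ∈ l) : IsPartition (l.map P) := by
  constructor
  · intro y
    obtain ⟨i, hi, -⟩ := h y
    exact ⟨P i, List.mem_map_of_mem (hm i), hi⟩
  · refine List.pairwise_map.mpr (hl.imp fun hij => sep_of_forall_notMem hk fun y hi hj => ?_)
    exact hij ((h y).unique hi hj)

theorem IsPartition.tiles {L : List (Brick k r)} (h : IsPartition L) :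
    Tiles fun b : {b // b ∈ L} => b.1 := by
  intro y
  obtain ⟨b, hb, hy⟩ := h.cover y
  refine ⟨⟨b, hb⟩, hy, fun c hc => Subtype.ext ?_⟩
  by_contra hne
  have : Std.Symm (Sep (k := k) (r := r)) := ⟨fun _ _ => Sep.symm⟩
  exact (h.pairwise.forall c.2 hb hne).notMem hc hy

theorem Classes.sq_eq_one (hk : 2 ≤ k) (h : Classes q t e) (hG : ∀ γ, IsElement γ → γ ∈ G)
    {b c : Brick k r} (hbc : Fits [b, c]) : e ^ 2 = 1 := by
  obtain ⟨R, hR, hp⟩ := hbc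
  obtain ⟨γ, hγ, hs⟩ := exists_isSwap hk hp
  have : (⟨γ, hG γ hγ⟩ : G) ^ 2 = 1 := by
    refine Subtype.ext (eq_of_acts hp fun d hd => ⟨d, ?_, Acts.one d⟩)
    rw [Subgroup.coe_pow, sq]
    simp only [List.cons_append, List.nil_append, List.mem_cons] at hd
    rcases hd with rfl | rfl | hd
    · exact hs.right.mul hs.left
    · exact hs.left.mul hs.right
    · have hd' : Acts γ d d := by
        refine Acts.of_fixed fun y hy => hs.fixed y (fun h1 => ?_) fun h1 => ?_
        · exact ((List.pairwise_cons.mp hp.pairwise).1 d (by simp [hd])).notMem h1 hy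
        · exact ((List.pairwise_cons.mp (List.pairwise_cons.mp hp.pairwise).2).1 d
            (by simp [hd])).notMem h1 hy
      exact hd'.mul hd'
  rw [← h.swap ⟨γ, hG γ hγ⟩ b c ⟨R, hR, hp⟩ hs, ← map_pow, this, map_one]

theorem Classes.map_of_perm (hk : 2 ≤ k) (h : Classes q t e) (hG : ∀ γ, IsElement γ → γ ∈ G)
    (he : e ^ 2 = 1) {ι : Type*} [Fintype ι] [DecidableEq ι] {P : ι → Brick k r} (hP : Tiles P)
    (hcard : 3 ≤ Fintype.card ι) (σ : Equiv.Perm ι) (γ : G)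
    (hγ : ∀ i, Acts γ.1 (P i) (P (σ i))) : q γ = if Equiv.Perm.sign σ = 1 then 1 else e := by
  have hpart := hP.isPartition (by omega) Finset.univ.nodup_toList (by simp)
  induction σ using Equiv.Perm.swap_induction_on generalizing γ with
  | one =>
    have : γ = 1 := by
      refine Subtype.ext (eq_of_acts hpart fun b hb => ⟨b, ?_, Acts.one b⟩)
      obtain ⟨i, -, rfl⟩ := List.mem_map.mp hb
      exact hγ i
    simp [this]
  | swap_mul f x y hxy ih =>
    have hfit : Fits [P x, P y] ∧ ∀ z, z ≠ x → z ≠ y → Sep (P x) (P z) ∧ Sep (P y) (P z) := by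
      refine ⟨⟨(((Finset.univ.erase x).erase y).toList).map P, ?_, ?_⟩, fun z hzx hzy => ?_⟩
      · intro h0
        have := congrArg List.length h0
        rw [List.length_map, Finset.length_toList, Finset.card_erase_of_mem (by simp [hxy.symm]),
          Finset.card_erase_of_mem (by simp), Finset.card_univ, List.length_nil] at this
        omega
      · refine hP.isPartition (l := x :: y :: ((Finset.univ.erase x).erase y).toList) (by omega)
          ?_ ?_
        · simp [hxy, Finset.nodup_toList]
        · intro z
          simp only [List.mem_cons, Finset.mem_toList, Finset.mem_erase, Finset.mem_univ]
          tauto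
      · exact ⟨sep_of_forall_notMem (by omega) fun w h1 h2 => hzx ((hP w).unique h2 h1),
          sep_of_forall_notMem (by omega) fun w h1 h2 => hzy ((hP w).unique h2 h1)⟩
    obtain ⟨⟨R, hR, hp⟩, hsep⟩ := hfit
    obtain ⟨s, hs, hsw⟩ := exists_isSwap hk hp
    have hact : ∀ z, Acts s (P z) (P (Equiv.swap x y z)) := by
      intro z
      by_cases hzx : z = x
      · subst hzx
        simpa using hsw.left
      by_cases hzy : z = y
      · subst hzy
        simpa using hsw.right
      rw [Equiv.swap_apply_of_ne_of_ne hzx hzy]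
      exact Acts.of_fixed fun w hw =>
        hsw.fixed w (fun h1 => (hsep z hzx hzy).1.notMem h1 hw)
          fun h1 => (hsep z hzx hzy).2.notMem h1 hw
    have hq := ih (⟨s, hG s hs⟩⁻¹ * γ) fun i => (hact (f i)).inv.mul (hγ i)
    rw [map_mul, map_inv, h.swap _ _ _ ⟨R, hR, hp⟩ hsw, inv_mul_eq_iff_eq_mul] at hq
    rw [hq, Equiv.Perm.sign_mul, Equiv.Perm.sign_swap hxy]
    rcases Int.units_eq_one_or (Equiv.Perm.sign f) with h1 | h1
    · simp [h1]
    · simp [h1, ← sq, he]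

theorem Classes.map_of_perm_list (hk : 2 ≤ k) (h : Classes q t e) (hG : ∀ γ, IsElement γ → γ ∈ G)
    (he : e ^ 2 = 1) {X : List (Brick k r)} (hX : IsPartition X) (hlen : 3 ≤ X.length) (γ : G)
    (hγ : ∀ b ∈ X, ∃ c ∈ X, Acts γ.1 b c) : q γ = 1 ∨ q γ = e := by
  classical
  choose φ hφ hφ' using hγ
  have : Fintype {b // b ∈ X} := Fintype.subtype X.toFinset (by simp)
  have hinj : Function.Injective fun b : {b // b ∈ X} => (⟨φ b.1 b.2, hφ b.1 b.2⟩ : {b // b ∈ X}) :=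
    fun b c hbc => Subtype.ext (eq_of_forall_pt_eq hk fun x => γ.1.injective <|
      (hφ' b.1 b.2 x).trans <| (congrArg (fun d => d.1.pt x) hbc).trans (hφ' c.1 c.2 x).symm)
  have hcard : 3 ≤ Fintype.card {b // b ∈ X} := by
    rwa [Fintype.card_of_subtype X.toFinset (by simp), List.toFinset_card_of_nodup hX.nodup]
  rw [h.map_of_perm hk hG he hX.tiles hcard
    (Equiv.ofBijective _ (Finite.injective_iff_bijective.mp hinj)) γ fun b => hφ' b.1 b.2]
  split_ifs <;> simp

end Classes

theorem list_prod_perm_apply {X ι : Type*} {φ : ι → Equiv.Perm X} {U : ι → Set X}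
    (hfix : ∀ i y, y ∉ U i → φ i y = y) (hdisj : ∀ i j y, y ∈ U i → y ∈ U j → i = j)
    {l : List ι} (hl : l.Nodup) :
    (∀ i ∈ l, ∀ y ∈ U i, (l.map φ).prod y = φ i y) ∧
      ∀ y, (∀ i ∈ l, y ∉ U i) → (l.map φ).prod y = y := by
  have hmem : ∀ i, ∀ y ∈ U i, φ i y ∈ U i := by
    intro i y hy
    by_contra hn
    rw [(φ i).injective (hfix i _ hn)] at hn
    exact hn hy
  induction l with
  | nil => simp
  | cons j l ih =>
    obtain ⟨hj, hl⟩ := List.nodup_cons.mp hl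
    obtain ⟨ih1, ih2⟩ := ih hl
    simp only [List.map_cons, List.prod_cons, Equiv.Perm.mul_apply]
    refine ⟨fun i hi y hy => ?_, fun y hy => ?_⟩
    · rcases List.mem_cons.mp hi with rfl | hi
      · rw [ih2 y fun i' hi' hy' => hj (hdisj _ _ y hy hy' ▸ hi')]
      · rw [ih1 i hi y hy, hfix j]
        intro hy'
        exact hj (hdisj _ _ _ hy' (hmem i y hy) ▸ hi)
    · rw [ih2 y fun i hi => hy i (List.mem_cons_of_mem _ hi), hfix j y (hy j List.mem_cons_self)]

theorem IsPartition.fits_singleton {L : List (Brick k r)} (hL : IsPartition L)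
    (hlen : 2 ≤ L.length) {b : Brick k r} (hb : b ∈ L) : Fits [b] := by
  classical
  have hp := List.perm_cons_erase hb
  refine ⟨L.erase b, fun h0 => ?_, hL.perm hp⟩
  have := hp.length_eq
  rw [h0] at this
  simp at this
  omega

theorem IsPartition.fits_pair {L : List (Brick k r)} (hL : IsPartition L) (hlen : 3 ≤ L.length)
    {b c : Brick k r} (hb : b ∈ L) (hc : c ∈ L) (hbc : c ≠ b) : Fits [b, c] := by
  classical
  have hp := (List.perm_cons_erase hb).trans
    ((List.perm_cons_erase ((List.mem_erase_of_ne hbc).mpr hc)).cons b)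
  refine ⟨(L.erase b).erase c, fun h0 => ?_, hL.perm hp⟩
  have := hp.length_eq
  rw [h0] at this
  simp at this
  omega

section Classes

variable {G : Subgroup (Equiv.Perm (Y 2 k r))} {A : Type*} [CommGroup A] {q : G →* A} {t e : A}

theorem map_list_prod_eq_pow {φ : Fin k → G} {a : A} (h : ∀ i, q (φ i) = a) :
    q (((List.finRange k).map φ).prod) = a ^ k := by
  rw [map_list_prod, List.map_map, List.map_congr_left (f := q ∘ φ) (g := fun _ => a) fun i _ => h i]
  simp

theorem coe_list_prod_map {ι : Type*} (φ : ι → G) (l : List ι) :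
    ((l.map φ).prod : G).1 = (l.map fun i => (φ i).1).prod := by
  rw [← Subgroup.coe_subtype, map_list_prod, List.map_map]
  rfl

theorem Classes.pow_swap (hk : 2 ≤ k) (h : Classes q t e) (hG : ∀ γ, IsElement γ → γ ∈ G)
    {b c : Brick k r} (hbc : Fits [b, c]) : e ^ k = e := by
  obtain ⟨R, hR, hp⟩ := hbc
  obtain ⟨γ, hγ, hs⟩ := exists_isSwap hk hp
  have hsep : Sep b c := (List.pairwise_cons.mp hp.pairwise).1 c (by simp)
  have hL : IsPartition (c.children 0 ++ (b.children 0 ++ R)) :=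
    (hp.split (s := 0).perm List.perm_middle).split
  have hlen : 3 ≤ (c.children 0 ++ (b.children 0 ++ R)).length := by
    have := List.length_pos_of_ne_nil hR
    simp only [List.length_append, length_children]
    omega
  have hfit : ∀ i, Fits [b.child 0 i, c.child 0 i] := fun i =>
    hL.fits_pair hlen (by simp [mem_children]) (by simp [mem_children])
      ((hsep.child_left 0 i).symm.child_left 0 i).ne
  choose φ hφ hφ' using fun i => exists_isSwap hk (hfit i).choose_spec.2
  have hprod := list_prod_perm_apply (φ := φ)
    (U := fun i => (b.child 0 i).carrier ∪ (c.child 0 i).carrier)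
    (fun i y hy => (hφ' i).fixed y (fun h1 => hy (Or.inl h1)) fun h1 => hy (Or.inr h1)) (by
      rintro i j y (h1 | h1) (h2 | h2)
      · by_contra hne
        exact (sep_child_child b hne).notMem h1 h2
      · exact absurd (carrier_child_subset _ _ _ h2) (hsep.notMem (carrier_child_subset _ _ _ h1))
      · exact absurd (carrier_child_subset _ _ _ h1) (hsep.notMem (carrier_child_subset _ _ _ h2))
      · by_contra hne
        exact (sep_child_child c hne).notMem h1 h2) (List.nodup_finRange k)
  have key : γ = ((List.finRange k).map φ).prod := by
    refine eq_of_acts hL fun d hd => ?_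
    rcases List.mem_append.mp hd with hd | hd
    · obtain ⟨i, rfl⟩ := mem_children.mp hd
      exact ⟨b.child 0 i, hs.right.child 0 i, fun x =>
        (hprod.1 i (List.mem_finRange i) _ (Or.inr (pt_mem _ x))).trans ((hφ' i).right x)⟩
    rcases List.mem_append.mp hd with hd' | hd'
    · obtain ⟨i, rfl⟩ := mem_children.mp hd'
      exact ⟨c.child 0 i, hs.left.child 0 i, fun x =>
        (hprod.1 i (List.mem_finRange i) _ (Or.inl (pt_mem _ x))).trans ((hφ' i).left x)⟩
    · have h1 := (List.pairwise_cons.mp hp.pairwise).1 d (by simp [hd'])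
      have h2 := (List.pairwise_cons.mp (List.pairwise_cons.mp hp.pairwise).2).1 d hd'
      refine ⟨d, Acts.of_fixed fun y hy => hs.fixed y (fun h3 => h1.notMem h3 hy)
        fun h3 => h2.notMem h3 hy, Acts.of_fixed fun y hy => hprod.2 y fun i _ hy' => ?_⟩
      rcases hy' with hy' | hy'
      · exact h1.notMem (carrier_child_subset _ _ _ hy') hy
      · exact h2.notMem (carrier_child_subset _ _ _ hy') hy
  rw [← map_list_prod_eq_pow (q := q) (φ := fun i => ⟨φ i, hG _ (hφ i)⟩) fun i =>
    h.swap _ _ _ (hfit i) (hφ' i), ← h.swap ⟨γ, hG γ hγ⟩ b c ⟨R, hR, hp⟩ hs]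
  congr 1
  exact Subtype.ext ((coe_list_prod_map _ _).trans key.symm)

theorem sign_prodComm (k : ℕ) :
    Equiv.Perm.sign (Equiv.prodComm (Fin k) (Fin k) : Equiv.Perm (Fin k × Fin k)) =
      (-1) ^ k.choose 2 := by
  have hfix : Fintype.card (Function.fixedPoints
      (Equiv.prodComm (Fin k) (Fin k) : Equiv.Perm (Fin k × Fin k))) = k := by
    have : Fin k ≃ Function.fixedPoints
        (Equiv.prodComm (Fin k) (Fin k) : Equiv.Perm (Fin k × Fin k)) :=
      { toFun := fun i => ⟨(i, i), rfl⟩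
        invFun := fun p => p.1.1
        left_inv := fun i => rfl
        right_inv := fun p => Subtype.ext <| Prod.ext rfl <|
          have h : p.1.swap = p.1 := p.2
          have h' : p.1.1 = p.1.2 := congrArg Prod.snd h
          h' }
    rw [← Fintype.card_congr this, Fintype.card_fin]
  rw [Equiv.Perm.sign_of_pow_two_eq_one, hfix, Fintype.card_prod, Fintype.card_fin,
    Nat.choose_two_right, Nat.mul_sub_one]
  ext p <;> rfl

theorem Classes.pow_twist (hk : 2 ≤ k) (h : Classes q t e) (hG : ∀ γ, IsElement γ → γ ∈ G)
    (he : e ^ 2 = 1) {b : Brick k r} (hb : Fits [b]) : t ^ k = t * e ^ k.choose 2 := by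
  obtain ⟨R, hR, hp⟩ := hb
  obtain ⟨θ, hθ, hs⟩ := exists_isTwist hk hp
  have hfix : ∀ d ∈ R, Sep b d := (List.pairwise_cons.mp hp.pairwise).1
  have hL : IsPartition (b.children 0 ++ R) := hp.split
  have hlen : 2 ≤ (b.children 0 ++ R).length := by
    simp only [List.length_append, length_children]
    omega
  have hfit : ∀ i, Fits [b.child 0 i] := fun i => hL.fits_singleton hlen (by simp [mem_children])
  choose φ hφ hφ' using fun i => exists_isTwist hk (hfit i).choose_spec.2
  obtain ⟨hprod, hprod'⟩ := list_prod_perm_apply (φ := φ)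
    (U := fun i => (b.child 0 i).carrier) (fun i y hy => (hφ' i).fixed y hy) (by
      intro i j y h1 h2
      by_contra hne
      exact (sep_child_child b hne).notMem h1 h2) (List.nodup_finRange k)
  set ω : G := ((List.finRange k).map fun i => (⟨φ i, hG _ (hφ i)⟩ : G)).prod with hω
  have hω' : ω.1 = ((List.finRange k).map φ).prod := coe_list_prod_map _ _
  have hact : ∀ i j, Acts ω.1 ((b.child 0 i).child 0 j) ((b.child 0 i).child 1 j) := by
    intro i j x
    rw [hω', hprod i (List.mem_finRange i) _ (carrier_child_subset _ _ _ (pt_mem _ x))]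
    exact (hφ' i).acts j x
  have hqω : q ω = t ^ k := map_list_prod_eq_pow fun i => h.twist _ _ (hfit i) (hφ' i)
  let P : (Fin k × Fin k) ⊕ {d // d ∈ R} → Brick k r :=
    Sum.elim (fun p => (b.child 0 p.1).child 1 p.2) Subtype.val
  have hP : Tiles P := by
    intro y
    obtain ⟨d, hd, hy⟩ := hp.cover y
    rcases List.mem_append.mp hd with hd | hd
    · obtain rfl := List.mem_singleton.mp hd
      obtain ⟨i, hi⟩ := exists_mem_child (s := 0) hy
      obtain ⟨j, hj⟩ := exists_mem_child (s := 1) hi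
      refine ⟨.inl (i, j), hj, ?_⟩
      rintro (⟨i', j'⟩ | ⟨d', hd'⟩) h'
      · have hi' : i' = i := by
          by_contra hne
          exact (sep_child_child d hne).notMem (carrier_child_subset _ _ _ h') hi
        subst hi'
        have hj' : j' = j := by
          by_contra hne
          exact (sep_child_child (d.child 0 i') hne).notMem h' hj
        rw [hj']
      · exact absurd h' ((hfix d' hd').notMem hy)
    · refine ⟨.inr ⟨d, hd⟩, hy, ?_⟩
      rintro (⟨i', j'⟩ | ⟨d', hd'⟩) h'
      · exact absurd hy ((hfix d hd).notMem
          (carrier_child_subset _ _ _ (carrier_child_subset _ _ _ h')))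
      · have := ((List.pairwise_cons.mp hp.pairwise).2)
        have hsymm : Std.Symm (Sep (k := k) (r := r)) := ⟨fun _ _ => Sep.symm⟩
        congr 2
        by_contra hne
        exact (this.forall hd' hd hne).notMem h' hy
  classical
  have : Fintype {d // d ∈ R} := Fintype.subtype R.toFinset (by simp)
  have hcard : 3 ≤ Fintype.card ((Fin k × Fin k) ⊕ {d // d ∈ R}) := by
    rw [Fintype.card_sum, Fintype.card_prod, Fintype.card_fin]
    nlinarith
  have hq := h.map_of_perm hk hG he hP hcard
    (Equiv.Perm.sumCongr (Equiv.prodComm (Fin k) (Fin k)) 1) (⟨θ, hG θ hθ⟩ * ω⁻¹) (by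
      rintro (⟨i, j⟩ | ⟨d, hd⟩)
      · have := ((hs.acts i).child 0 j).mul (hact i j).inv
        simp only [P, Equiv.Perm.sumCongr_apply, Sum.map_inl, Sum.elim_inl, Equiv.prodComm_apply,
          Prod.swap_prod_mk]
        rw [child_comm j i]
        exact this
      · have h1 : Acts θ d d := Acts.of_fixed fun y hy =>
          hs.fixed y fun hy' => (hfix d hd).notMem hy' hy
        have h2 : Acts ω.1 d d := Acts.of_fixed fun y hy => hω' ▸ hprod' y fun i _ hy' =>
          (hfix d hd).notMem (carrier_child_subset _ _ _ hy') hy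
        exact h1.mul h2.inv)
  have hval : (if (-1 : ℤˣ) ^ k.choose 2 = 1 then 1 else e) = e ^ k.choose 2 := by
    rcases Nat.even_or_odd' (k.choose 2) with ⟨m, hm | hm⟩
    · simp [hm, pow_mul, he]
    · simp [hm, pow_succ, pow_mul, he]
  rw [map_mul, map_inv, hqω, h.twist _ _ ⟨R, hR, hp⟩ hs, Equiv.Perm.sign_sumCongr,
    Equiv.Perm.sign_one, mul_one, sign_prodComm, hval, mul_inv_eq_iff_eq_mul] at hq
  have he' : (e ^ k.choose 2) * e ^ k.choose 2 = 1 := by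
    rw [← sq, ← pow_mul, mul_comm, pow_mul, he, one_pow]
  conv_rhs => rw [hq, mul_right_comm, he', one_mul]

end Classes

/-- The first box is cut in direction `0`. -/
def splitHead : List (Brick k r) → List (Brick k r)
  | [] => []
  | b :: R => b.children 0 ++ R

theorem IsPartition.splitHead {L : List (Brick k r)} (h : IsPartition L) :
    IsPartition (splitHead L) := by
  cases L with
  | nil => exact h
  | cons b R => exact h.split

theorem IsPartition.iterate_splitHead {L : List (Brick k r)} (h : IsPartition L) (n : ℕ) :
    IsPartition (NV.splitHead^[n] L) := by
  induction n with
  | zero => exact h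
  | succ n ih =>
    rw [Function.iterate_succ_apply']
    exact ih.splitHead

theorem length_iterate_splitHead (hk : 1 ≤ k) {L : List (Brick k r)} (hL : L ≠ []) (n : ℕ) :
    (splitHead^[n] L).length = L.length + n * (k - 1) := by
  induction n with
  | zero => simp
  | succ n ih =>
    have := List.length_pos_of_ne_nil hL
    rw [Function.iterate_succ_apply']
    rcases h : splitHead^[n] L with _ | ⟨b, R⟩
    · rw [h, List.length_nil] at ih
      omega
    · rw [h, List.length_cons] at ih
      simp only [splitHead, List.length_append, length_children, add_mul]
      omega

theorem map_img_of_forall₂ (hk : 2 ≤ k) {γ : Equiv.Perm (Y 2 k r)} {L L' : List (Brick k r)}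
    (h : List.Forall₂ (Acts γ) L L') : (∀ b ∈ L, Nice γ b) ∧ L.map (img γ) = L' := by
  induction h with
  | nil => simp
  | cons h _ ih =>
    simp only [List.mem_cons, List.map_cons, h.img_eq hk, ih.2, and_true]
    rintro b (rfl | hb)
    · exact h.nice
    · exact ih.1 b hb

theorem forall₂_acts_img {γ : Equiv.Perm (Y 2 k r)} {L : List (Brick k r)}
    (h : ∀ b ∈ L, Nice γ b) : List.Forall₂ (Acts γ) L (L.map (img γ)) := by
  rw [List.forall₂_map_right_iff, List.forall₂_same]
  exact fun b hb => (h b hb).acts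

theorem forall₂_acts_mul {γ δ : Equiv.Perm (Y 2 k r)} {L M N : List (Brick k r)}
    (h : List.Forall₂ (Acts γ) M N) (h' : List.Forall₂ (Acts δ) L M) :
    List.Forall₂ (Acts (γ * δ)) L N := by
  induction h' generalizing N with
  | nil => cases h; exact .nil
  | cons h1 _ ih =>
    cases h with
    | cons h2 h3 => exact .cons (h2.mul h1) (ih h3)

theorem forall₂_acts_inv {γ : Equiv.Perm (Y 2 k r)} {L M : List (Brick k r)}
    (h : List.Forall₂ (Acts γ) L M) : List.Forall₂ (Acts γ⁻¹) M L :=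
  h.flip.imp fun _ _ => Acts.inv

theorem IsSwap.forall₂_acts {γ : Equiv.Perm (Y 2 k r)} {b c : Brick k r} (h : IsSwap γ b c)
    {R : List (Brick k r)} (hp : IsPartition ([b, c] ++ R)) :
    List.Forall₂ (Acts γ) ([b, c] ++ R) ([c, b] ++ R) := by
  obtain ⟨h1, h2⟩ := List.pairwise_cons.mp hp.pairwise
  have h3 := (List.pairwise_cons.mp h2).1
  refine .cons h.left (.cons h.right (List.forall₂_same.mpr fun d hd => ?_))
  exact Acts.of_fixed fun y hy => h.fixed y (fun h' => (h1 d (List.mem_cons_of_mem _ hd)).notMem h' hy)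
    fun h' => (h3 d hd).notMem h' hy

theorem IsTwist.forall₂_acts {γ : Equiv.Perm (Y 2 k r)} {b : Brick k r} (h : IsTwist γ b)
    {R : List (Brick k r)} (hp : IsPartition ([b] ++ R)) :
    List.Forall₂ (Acts γ) (b.children 0 ++ R) (b.children 1 ++ R) := by
  have h1 := (List.pairwise_cons.mp hp.pairwise).1
  refine List.rel_append ?_ (List.forall₂_same.mpr fun d hd => ?_)
  · rw [Brick.children, Brick.children, List.forall₂_map_left_iff, List.forall₂_map_right_iff,
      List.forall₂_same]
    exact fun i _ => h.acts i
  · exact Acts.of_fixed fun y hy => h.fixed y fun h' => (h1 d hd).notMem h' hy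

section Classes

variable {G : Subgroup (Equiv.Perm (Y 2 k r))} {A : Type*} [CommGroup A] {q : G →* A} {t e : A}

theorem Classes.exists_forall₂_iterate (hk : 2 ≤ k) (h : Classes q t e)
    (hG : ∀ γ, IsElement γ → γ ∈ G) (he : e ^ 2 = 1) {H : Subgroup A} (heH : e ∈ H) (htH : t ∈ H)
    {L₀ L : List (Brick k r)} (hL₀ : IsPartition L₀) (hlen : 3 ≤ L₀.length) (hL : Refines L₀ L) :
    ∃ (n : ℕ) (γ : G), List.Forall₂ (Acts γ.1) L (splitHead^[n] L₀) ∧ q γ ∈ H := by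
  have hne : L₀ ≠ [] := by
    rintro rfl
    simp at hlen
  have hSlen : ∀ n, 3 ≤ (splitHead^[n] L₀).length := fun n => by
    rw [length_iterate_splitHead (by omega) hne]
    omega
  induction hL with
  | refl => exact ⟨0, 1, List.forall₂_same.mpr fun b _ => Acts.one b, by simp⟩
  | @tail M M' hM hm ih =>
    obtain ⟨n, γ, hγ, hq⟩ := ih
    have hMp := Refines.isPartition hM hL₀
    have hSp := hL₀.iterate_splitHead n
    cases hm with
    | perm hp =>
      have hMp' := hMp.perm hp
      obtain ⟨δ, hδ, hδF⟩ := exists_forall₂_acts hk hMp' hSp (hp.length_eq ▸ hγ.length_eq)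
      refine ⟨n, ⟨δ, hG δ hδ⟩, hδF, ?_⟩
      have hF := forall₂_acts_mul (forall₂_acts_inv hγ) hδF
      have h1 : q (γ⁻¹ * ⟨δ, hG δ hδ⟩) ∈ H := by
        rcases h.map_of_perm_list hk hG he hMp'
          (by rw [hδF.length_eq]; exact hSlen n) (γ⁻¹ * ⟨δ, hG δ hδ⟩) (by
            intro b hb
            obtain ⟨m, hm, rfl⟩ := List.getElem_of_mem hb
            have hm' := hF.length_eq ▸ hm
            exact ⟨M[m], hp.mem_iff.mp (List.getElem_mem hm'),
              (List.forall₂_iff_get.mp hF).2 m hm hm'⟩) with h1 | h1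
        · rw [h1]
          exact H.one_mem
        · rwa [h1]
      rw [map_mul, map_inv] at h1
      exact (H.mul_mem_cancel_left (H.inv_mem hq)).mp h1
    | split s b R =>
      rcases hS : splitHead^[n] L₀ with _ | ⟨b', R'⟩
      · have := hSlen n
        rw [hS] at this
        simp at this
      rw [hS] at hγ hSp
      have hlen' := hSlen n
      rw [hS] at hlen'
      obtain ⟨h1, h2⟩ := List.forall₂_cons.mp hγ
      have hnext : splitHead^[n + 1] L₀ = b'.children 0 ++ R' := by
        rw [Function.iterate_succ_apply', hS, splitHead]
      rcases (by omega : s = 0 ∨ s = 1) with rfl | rfl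
      · exact ⟨n + 1, γ, hnext ▸ List.rel_append (h1.children 0) h2, hq⟩
      · obtain ⟨θ, hθ, hθ'⟩ := exists_isTwist hk (b := b') (R := R') hSp
        refine ⟨n + 1, ⟨θ, hG θ hθ⟩⁻¹ * γ, ?_, ?_⟩
        · rw [hnext]
          exact forall₂_acts_mul (forall₂_acts_inv (hθ'.forall₂_acts hSp))
            (List.rel_append (h1.children 1) h2)
        · rw [map_mul, map_inv, h.twist _ b'
            (hSp.fits_singleton (by omega) List.mem_cons_self) hθ']
          exact H.mul_mem (H.inv_mem htH) hq

theorem Classes.map_mem (hk : 2 ≤ k) (h : Classes q t e) (hG : ∀ γ, γ ∈ G ↔ IsElement γ)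
    (he : e ^ 2 = 1) {H : Subgroup A} (heH : e ∈ H) (htH : t ∈ H)
    {L₀ : List (Brick k r)} (hL₀ : IsPartition L₀) (hlen : 3 ≤ L₀.length) (γ : G) : q γ ∈ H := by
  have hG' : ∀ γ, IsElement γ → γ ∈ G := fun γ => (hG γ).mpr
  have hne : L₀ ≠ [] := by
    rintro rfl
    simp at hlen
  obtain ⟨N, hN, hNγ⟩ := (isElement_iff hk).mp ((hG γ.1).mp γ.2)
  obtain ⟨X, hX, hX'⟩ := exists_common_refines (by omega) hN hL₀
  have hXγ := Refines.nice hX hNγ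
  obtain ⟨Z, hZ, hZ'⟩ := exists_common_refines (by omega)
    (isPartition_map_img (by omega) (Refines.isPartition hX hN) hXγ) hL₀
  obtain ⟨M, hM, rfl⟩ := Refines.exists_lift hk hXγ hZ
  obtain ⟨n, α, hα, hαH⟩ :=
    h.exists_forall₂_iterate hk hG' he heH htH hL₀ hlen (hX'.trans hM)
  obtain ⟨m, β, hβ, hβH⟩ := h.exists_forall₂_iterate hk hG' he heH htH hL₀ hlen hZ'
  have hnm : n = m := by
    have h1 := hα.length_eq
    have h2 := hβ.length_eq
    rw [List.length_map] at h2
    rw [h2, length_iterate_splitHead (by omega) hne, length_iterate_splitHead (by omega) hne,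
      add_right_inj] at h1
    exact (Nat.eq_of_mul_eq_mul_right (by omega) h1).symm
  subst hnm
  have hMγ := Refines.nice hM hXγ
  have key : β * γ = α := Subtype.ext <|
    eq_of_forall₂_acts (Refines.isPartition (hX'.trans hM) hL₀)
      (forall₂_acts_mul hβ (forall₂_acts_img hMγ)) hα
  rw [← key, map_mul] at hαH
  exact (H.mul_mem_cancel_left hβH).mp hαH

end Classes

theorem exists_isPartition (hk : 2 ≤ k) (hr : 1 ≤ r) :
    ∃ (b c : Brick k r) (R : List (Brick k r)), R ≠ [] ∧ IsPartition ([b, c] ++ R) := by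
  have hroot : IsPartition ([] ++ (List.finRange r).map fun a => (⟨fun _ => [], a⟩ : Brick k r)) := by
    rw [List.nil_append]
    refine Tiles.isPartition (by omega) (fun y => ⟨y.2, ⟨y.1, ?_⟩, ?_⟩) (List.nodup_finRange r)
      List.mem_finRange
    · refine Prod.ext (funext fun i => funext fun j => ?_) rfl
      simp [concat]
    · rintro a ⟨x, hx⟩
      exact (congrArg Prod.snd hx).symm
  obtain ⟨L, -, hL, hlen⟩ := hroot.exists_append hk (by
    intro h0
    have := congrArg List.length h0
    simp at this
    omega) 2
  simp only [List.length_map, List.length_finRange] at hlen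
  match L, hL, hlen with
  | b :: c :: d :: R, hL, _ => exact ⟨b, c, d :: R, by simp, hL⟩
  | [_, _], _, hlen => simp at hlen; omega
  | [_], _, hlen => simp at hlen; omega
  | [], _, hlen => simp at hlen; omega

/-- An abelian group generated by `t` and `ε`, universal for the given relations, is isomorphic to
the abelianization. -/
theorem nonempty_abelianization_mulEquiv (hk : 2 ≤ k) (hr : 1 ≤ r)
    {G : Subgroup (Equiv.Perm (Y 2 k r))} (hG : ∀ γ, γ ∈ G ↔ IsElement γ)
    {T : Type} [AddCommGroup T] {t ε : T} (hrel : Relations k t ε)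
    (hgen : AddSubgroup.closure {t, ε} = ⊤)
    (huniv : ∀ {A : Type} [AddCommGroup A] {t' ε' : A}, Relations k t' ε' →
      ∃ ψ : T →+ A, ψ t = t' ∧ ψ ε = ε') :
    Nonempty (Abelianization G ≃* Multiplicative T) := by
  have hG' : ∀ γ, IsElement γ → γ ∈ G := fun γ => (hG γ).mpr
  obtain ⟨b, c, R, hR, hp⟩ := exists_isPartition hk hr
  obtain ⟨σ, hσ, hσ'⟩ := exists_isSwap hk hp
  obtain ⟨τ, hτ, hτ'⟩ := exists_isTwist (b := b) (R := c :: R) hk hp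
  obtain ⟨f, hf⟩ := exists_weightHom hk hrel G fun γ hγ => (hG γ).mp hγ
  have hf' : ∀ (γ : G) (L L' : List (Brick k r)), IsPartition L → List.Forall₂ (Acts γ.1) L L' →
      f γ = Multiplicative.ofAdd (listWeight t ε L - listWeight t ε L') := by
    intro γ L L' hL hF
    obtain ⟨h1, h2⟩ := map_img_of_forall₂ hk hF
    rw [hf γ L hL h1, weightChange, h2]
  have hfσ : f ⟨σ, hG' σ hσ⟩ = Multiplicative.ofAdd ε := by
    rw [hf' _ _ _ hp (hσ'.forall₂_acts hp)]
    simp only [List.cons_append, List.nil_append]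
    rw [listWeight_swap hrel ((List.pairwise_cons.mp hp.pairwise).1 c (by simp)), sub_add_cancel_left,
      hrel.neg]
  have hfτ : f ⟨τ, hG' τ hτ⟩ = Multiplicative.ofAdd t := by
    have hsep : ∀ d ∈ c :: R, Sep b d := (List.pairwise_cons.mp hp.pairwise).1
    rw [hf' _ (b.children 0 ++ c :: R) (b.children 1 ++ c :: R)
      (IsPartition.split (R := c :: R) hp) (hτ'.forall₂_acts (R := c :: R) hp),
      listWeight_split hrel 0 b (c :: R) hsep, listWeight_split hrel 1 b (c :: R) hsep]
    simp
  have hbc : Fits [b, c] := ⟨R, hR, hp⟩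
  have hb : Fits [b] := ⟨c :: R, by simp, hp⟩
  set q : G →* Abelianization G := Abelianization.of with hq
  have hcl : Classes q (q ⟨τ, hG' τ hτ⟩) (q ⟨σ, hG' σ hσ⟩) :=
    classes_of_isSwap_of_isTwist hk hG' q hbc hb hσ' hτ'
  set e := q ⟨σ, hG' σ hσ⟩ with he
  set s := q ⟨τ, hG' τ hτ⟩ with hs
  have hsq := hcl.sq_eq_one hk hG' hbc
  have hrel' : Relations k (Additive.ofMul s) (Additive.ofMul e) := by
    refine ⟨?_, ?_, ?_⟩
    · rw [← ofMul_pow, hsq, ofMul_one]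
    · rw [← ofMul_pow, hcl.pow_swap hk hG' hbc]
    · rw [← ofMul_pow, ← ofMul_pow, ← ofMul_mul, hcl.pow_twist hk hG' hsq hb]
  obtain ⟨ψ, hψt, hψε⟩ := huniv hrel'
  set Ψ : Multiplicative T →* Abelianization G := AddMonoidHom.toMultiplicativeLeft ψ with hΨ
  have hΨt : Ψ (Multiplicative.ofAdd t) = s := congrArg Additive.toMul hψt
  have hΨε : Ψ (Multiplicative.ofAdd ε) = e := congrArg Additive.toMul hψε
  set F : Abelianization G →* Multiplicative T := Abelianization.lift f with hF
  have hleft : ∀ x, F (Ψ x) = x := by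
    have hcomp : (MonoidHom.toAdditiveLeft (F.comp Ψ) : T →+ T) = AddMonoidHom.id T := by
      refine AddMonoidHom.eq_of_eqOn_dense hgen ?_
      rintro x (rfl | rfl)
      · exact (congrArg F hΨt).trans hfτ
      · exact (congrArg F hΨε).trans hfσ
    exact fun x => DFunLike.congr_fun hcomp x.toAdd
  have hsurj : Function.Surjective Ψ := by
    intro x
    obtain ⟨γ, rfl⟩ := QuotientGroup.mk_surjective x
    exact hcl.map_mem hk hG hsq (H := Ψ.range) ⟨_, hΨε⟩ ⟨_, hΨt⟩ hp (by
      have := List.length_pos_of_ne_nil hR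
      simp
      omega) γ
  exact ⟨(MulEquiv.ofBijective Ψ ⟨Function.LeftInverse.injective hleft, hsurj⟩).symm⟩

section Relations

variable {A : Type*} [AddCommGroup A] {t ε : A}

theorem Relations.pred_nsmul_tau (h : Relations k t ε) (hk : 1 ≤ k) :
    (k - 1) • t = k.choose 2 • ε := by
  have := h.nsmul_tau
  obtain ⟨m, rfl⟩ := Nat.exists_eq_add_of_le' hk
  rw [add_nsmul, one_nsmul, add_comm, add_right_inj] at this
  simpa using this

theorem Relations.of_pred (hk : 1 ≤ k) (h2 : 2 • ε = 0) (hε : (k - 1) • ε = 0)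
    (ht : (k - 1) • t = k.choose 2 • ε) : Relations k t ε := by
  obtain ⟨m, rfl⟩ := Nat.exists_eq_add_of_le' hk
  rw [Nat.add_sub_cancel] at hε ht
  exact ⟨h2, by rw [add_nsmul, hε, zero_add, one_nsmul], by rw [add_nsmul, ht, one_nsmul, add_comm]⟩

theorem exists_zmod_hom {n : ℕ} (a : A) (h : n • a = 0) : ∃ ψ : ZMod n →+ A, ψ 1 = a := by
  refine ⟨ZMod.lift n ⟨zmultiplesHom A a, by simpa using h⟩, ?_⟩
  have := ZMod.lift_coe n ⟨zmultiplesHom A a, by simpa using h⟩ 1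
  simpa using this

end Relations

theorem map_mem_closure {n : ℕ} {A : Type*} [AddCommGroup A] (φ : ZMod n →+ A)
    {S : Set A} (h : φ 1 ∈ S) (x : ZMod n) : φ x ∈ AddSubgroup.closure S := by
  obtain ⟨m, rfl⟩ := ZMod.intCast_surjective x
  rw [← zsmul_one, map_zsmul]
  exact AddSubgroup.zsmul_mem _ (AddSubgroup.mem_closure_of_mem h) m

theorem closure_zmod (n : ℕ) (ε : ZMod n) : AddSubgroup.closure {1, ε} = ⊤ := by
  rw [AddSubgroup.eq_top_iff']
  intro x
  have h : AddMonoidHom.id (ZMod n) 1 ∈ ({1, ε} : Set (ZMod n)) := Set.mem_insert _ _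
  exact map_mem_closure _ h x

theorem closure_zmod_prod (m n : ℕ) :
    AddSubgroup.closure {((1, 0) : ZMod m × ZMod n), (0, 1)} = ⊤ := by
  rw [AddSubgroup.eq_top_iff']
  intro x
  have h1 : AddMonoidHom.inl (ZMod m) (ZMod n) 1 ∈
      ({(1, 0), (0, 1)} : Set (ZMod m × ZMod n)) := Set.mem_insert _ _
  have h2 : AddMonoidHom.inr (ZMod m) (ZMod n) 1 ∈
      ({(1, 0), (0, 1)} : Set (ZMod m × ZMod n)) := Set.mem_insert_of_mem _ rfl
  have hx : x = AddMonoidHom.inl (ZMod m) (ZMod n) x.1 +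
      AddMonoidHom.inr (ZMod m) (ZMod n) x.2 := by simp
  rw [hx]
  exact AddSubgroup.add_mem _ (map_mem_closure _ h1 x.1) (map_mem_closure _ h2 x.2)

theorem two_mul_choose_two (k : ℕ) : 2 * k.choose 2 = k * (k - 1) := by
  rw [Nat.choose_two_right, Nat.mul_div_cancel' (Nat.even_mul_pred_self k).two_dvd]

theorem choose_two_mod_of_mod_four_eq_one (h : k % 4 = 1) : k.choose 2 % 2 = 0 := by
  have h2 := two_mul_choose_two k
  obtain ⟨m, rfl⟩ : ∃ m, k = 4 * m + 1 := ⟨k / 4, by omega⟩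
  rw [Nat.add_sub_cancel] at h2
  have : (4 * m + 1).choose 2 = 2 * ((4 * m + 1) * m) := by nlinarith
  omega

theorem choose_two_mod_of_mod_four_eq_three (h : k % 4 = 3) : k.choose 2 % 2 = 1 := by
  have h2 := two_mul_choose_two k
  obtain ⟨m, rfl⟩ : ∃ m, k = 4 * m + 3 := ⟨k / 4, by omega⟩
  rw [show 4 * m + 3 - 1 = 4 * m + 2 by omega] at h2
  have : (4 * m + 3).choose 2 = 2 * (4 * (m * m) + 5 * m + 1) + 1 := by nlinarith
  omega

end NV

theorem statement2 (k r : ℕ) (hk : 2 ≤ k) (hr : 1 ≤ r)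
    (G : Subgroup (Equiv.Perm (NV.Y 2 k r)))
    (hG : (G : Set (Equiv.Perm (NV.Y 2 k r))) = NV.thompsonSet 2 k r) :
    (Even k → Nonempty (Abelianization ↥G ≃* Multiplicative (ZMod (k - 1)))) ∧
    (k % 4 = 1 → Nonempty (Abelianization ↥G ≃* Multiplicative (ZMod (k - 1) × ZMod 2))) ∧
    (k % 4 = 3 → Nonempty (Abelianization ↥G ≃* Multiplicative (ZMod (2 * k - 2)))) := by
  have hG' : ∀ γ, γ ∈ G ↔ NV.IsElement γ := fun γ => by
    rw [← SetLike.mem_coe, hG]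
    rfl
  have hk1 : 1 ≤ k := by omega
  refine ⟨fun heven => ?_, fun h1 => ?_, fun h3 => ?_⟩
  · refine NV.nonempty_abelianization_mulEquiv hk hr hG' (t := (1 : ZMod (k - 1))) (ε := 0)
      (.of_pred hk1 (by simp) (by simp) (by simp)) ?_ ?_
    · exact NV.closure_zmod _ _
    · intro A _ t ε h
      have hε : ε = 0 := by
        rw [← h.nsmul_eps, h.nsmul_congr (n := 0) (by rw [Nat.even_iff.mp heven]), zero_nsmul]
      obtain ⟨ψ, hψ⟩ := NV.exists_zmod_hom t (n := k - 1) (by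
        rw [h.pred_nsmul_tau hk1, hε, nsmul_zero])
      exact ⟨ψ, hψ, by rw [map_zero, hε]⟩
  · have hC := NV.choose_two_mod_of_mod_four_eq_one h1
    refine NV.nonempty_abelianization_mulEquiv hk hr hG' (t := ((1, 0) : ZMod (k - 1) × ZMod 2))
      (ε := (0, 1)) (.of_pred hk1 ?_ ?_ ?_) ?_ ?_
    · exact Prod.ext (by simp) rfl
    · refine Prod.ext (by simp) ?_
      simpa using (ZMod.natCast_eq_zero_iff (k - 1) 2).mpr (by omega)
    · refine Prod.ext (by simp) ?_
      simpa using ((ZMod.natCast_eq_zero_iff (k.choose 2) 2).mpr (by omega)).symm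
    · exact NV.closure_zmod_prod _ _
    · intro A _ t ε h
      obtain ⟨ψ, hψ⟩ := NV.exists_zmod_hom t (n := k - 1) (by
        rw [h.pred_nsmul_tau hk1, h.nsmul_congr (n := 0) hC, zero_nsmul])
      obtain ⟨φ, hφ⟩ := NV.exists_zmod_hom ε (n := 2) h.two_nsmul
      exact ⟨ψ.coprod φ, by simp [hψ], by simp [hφ]⟩
  · have hC := NV.choose_two_mod_of_mod_four_eq_three h3
    have hzero : ((2 * k - 2 : ℕ) : ZMod (2 * k - 2)) = 0 := ZMod.natCast_self _
    have htwo : 2 • ((k - 1 : ℕ) : ZMod (2 * k - 2)) = 0 := by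
      rw [nsmul_eq_mul, ← Nat.cast_mul, Nat.mul_sub, mul_one, hzero]
    have heven : ∀ m, m % 2 = 0 → m • ((k - 1 : ℕ) : ZMod (2 * k - 2)) = 0 := fun m hm => by
      rw [← Nat.div_mul_cancel (Nat.dvd_of_mod_eq_zero hm), mul_nsmul', htwo, nsmul_zero]
    refine NV.nonempty_abelianization_mulEquiv hk hr hG' (t := (1 : ZMod (2 * k - 2)))
      (ε := ((k - 1 : ℕ) : ZMod (2 * k - 2))) (.of_pred hk1 htwo (heven _ (by omega)) ?_) ?_ ?_
    · rw [← Nat.mod_add_div (k.choose 2) 2, hC, add_nsmul, heven _ (Nat.mul_mod_right _ _),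
        add_zero, one_nsmul, nsmul_one]
    · exact NV.closure_zmod _ _
    · intro A _ t ε h
      have ht : (k - 1) • t = ε := by
        rw [h.pred_nsmul_tau hk1, h.nsmul_congr (n := 1) hC, one_nsmul]
      obtain ⟨ψ, hψ⟩ := NV.exists_zmod_hom t (n := 2 * k - 2) (by
        rw [show 2 * k - 2 = 2 * (k - 1) by omega, mul_nsmul', ht, h.two_nsmul])
      exact ⟨ψ, hψ, by rw [← nsmul_one, map_nsmul, hψ, ht]⟩
end
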